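/- arXiv:1608.02140 — 2 statements merged into one kernel-verified Lean document; each statement's English description precedes it below -/
import Mathlib

section
/- For every d ≥ 3 there exists a d-dimensional pseudomanifold that is Mogami but not LC. -/
open Finset

namespace MogamiPaper

/-- A configuration of `N` labelled `d`-simplices with vertices in `V`:
facet `i` has vertex list `f i`. Vertex identifications (gluings) are recorded
by the labelling map. -/
abbrev Config (V : Type*) (d N : ℕ) := Fin N → Fin (d + 1) → V

variable {V : Type*} [DecidableEq V] {d N : ℕ}

/-- the vertex set of the `i`-th facet -/
def facet (f : Config V d N) (i : Fin N) : Finset V :=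
  Finset.image (f i) Finset.univ

/-- each facet has `d+1` distinct vertices -/
def Proper (f : Config V d N) : Prop := ∀ i, Function.Injective (f i)

/-- the facets containing a given set of vertices -/
def cells (f : Config V d N) (R : Finset V) : Finset (Fin N) :=
  Finset.univ.filter fun i => R ⊆ facet f i

/-- pseudomanifold: proper, and every `(d-1)`-face lies in at most two facets -/
def IsPseudo (f : Config V d N) : Prop :=
  Proper f ∧ ∀ R : Finset V, R.card = d → (cells f R).card ≤ 2

/-- a boundary `(d-1)`-face: contained in exactly one facet -/
def IsBdryRidge (f : Config V d N) (R : Finset V) : Prop :=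
  R.card = d ∧ (cells f R).card = 1

/-- A gluing step: identify two distinct boundary `(d-1)`-faces `R`, `S`, whose
intersection cardinality satisfies `P`, via a vertex identification `φ` that maps
`R` bijectively onto `S` and fixes everything outside `R`. -/
def Step (P : ℕ → Prop) (f g : Config V d N) : Prop :=
  ∃ R S : Finset V, IsBdryRidge f R ∧ IsBdryRidge f S ∧ R ≠ S ∧ P ((R ∩ S).card) ∧
    ∃ φ : V → V, (∀ v, v ∉ R → φ v = v) ∧ Set.InjOn φ ↑R ∧ R.image φ = S ∧
      ∀ i j, g i j = φ (f i j)

/-- Mogami gluing: the glued boundary facets share at least a vertex -/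
def MogamiStep (f g : Config V d N) : Prop := Step (fun c => 1 ≤ c) f g

/-- LC gluing: the glued boundary facets share a `(d-2)`-face -/
def LCStep (f g : Config V d N) : Prop := Step (fun c => c = d - 1) f g

/-- the dual graph: two facets are adjacent if they share a `(d-1)`-face -/
def dualGraph (f : Config V d N) : SimpleGraph (Fin N) :=
  SimpleGraph.fromRel fun i i' =>
    ∃ R : Finset V, R.card = d ∧ R ⊆ facet f i ∧ R ⊆ facet f i'

/-- UNITE: glue two disjoint boundary facets belonging to (dually) disconnected parts -/
def UniteStep (f g : Config V d N) : Prop :=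
  ∃ R S : Finset V, IsBdryRidge f R ∧ IsBdryRidge f S ∧ Disjoint R S ∧
    (∀ i ∈ cells f R, ∀ i' ∈ cells f S, ¬ (dualGraph f).Reachable i i') ∧
    ∃ φ : V → V, (∀ v, v ∉ R → φ v = v) ∧ Set.InjOn φ ↑R ∧ R.image φ = S ∧
      ∀ i j, g i j = φ (f i j)

/-- the canonical configuration of `N` pairwise disjoint `d`-simplices -/
def std (d N : ℕ) : Config (Fin N × Fin (d + 1)) d N := fun i j => (i, j)

/-- a tree of `d`-simplices (over the canonical vertex pool): obtained from `N`
disjoint simplices by UNITE steps, with connected (hence tree) dual graph -/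
def IsTreeOfSimplicesC (t : Config (Fin N × Fin (d + 1)) d N) : Prop :=
  Relation.ReflTransGen UniteStep (std d N) t ∧ (dualGraph t).Connected

/-- `g` represents `f` up to an injective relabeling of the used vertices -/
def Represents (g : Config (Fin N × Fin (d + 1)) d N) (f : Config V d N) : Prop :=
  ∃ e : Fin N × Fin (d + 1) → V,
    Set.InjOn e {x | ∃ i j, g i j = x} ∧ ∀ i j, f i j = e (g i j)

/-- Mogami: obtainable from a tree of `d`-simplices by Mogami gluings -/
def IsMogami (f : Config V d N) : Prop :=
  ∃ t g : Config (Fin N × Fin (d + 1)) d N,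
    IsTreeOfSimplicesC t ∧ Relation.ReflTransGen MogamiStep t g ∧ Represents g f

/-- locally constructible: obtainable from a tree of `d`-simplices by LC gluings -/
def IsLC (f : Config V d N) : Prop :=
  ∃ t g : Config (Fin N × Fin (d + 1)) d N,
    IsTreeOfSimplicesC t ∧ Relation.ReflTransGen LCStep t g ∧ Represents g f

/-- the geometric realization, as a subspace of `V → ℝ` -/
def realization [Fintype V] (f : Config V d N) : Set (V → ℝ) :=
  {x | (∀ v, 0 ≤ x v) ∧ (∑ v, x v) = 1 ∧ ∃ i : Fin N, ∀ v, x v ≠ 0 → v ∈ facet f i}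

/-- a triangulated `d`-ball: realization homeomorphic to the unit ball of `ℝ^d` -/
def IsBall [Fintype V] (f : Config V d N) : Prop :=
  Nonempty ((realization f) ≃ₜ
    (Metric.closedBall (0 : EuclideanSpace ℝ (Fin d)) 1 : Set (EuclideanSpace ℝ (Fin d))))

/-- all vertices lie on the boundary -/
def NoInteriorVertices (f : Config V d N) : Prop :=
  ∀ i j, ∃ R : Finset V, IsBdryRidge f R ∧ f i j ∈ R

/-- the cone over a configuration, with apex `v` -/
def cone (f : Config V d N) (v : V) : Config V (d + 1) N :=
  fun i => Fin.cons v (f i)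

end MogamiPaper

namespace MogamiPaper

section Obstruction

variable {U V : Type*} {d N : ℕ}

/-- Corners identified in `h` are identified in `f`. -/
def Refines (h : Config U d N) (f : Config V d N) : Prop :=
  ∀ i j i' j', h i j = h i' j' → f i j = f i' j'

/-- The heights `η`, defined on the corners of each simplex over the vertex set `B` of `f`, can be
shifted simplexwise so as to agree on all corners identified in `h`. -/
def HasPotential (h : Config U d N) (f : Config V d N) (B : Set V)
    (η : Fin N → Fin (d + 1) → ℤ) : Prop :=
  ∃ q : Fin N → ℤ, ∀ i j i' j', h i j = h i' j' → f i j ∈ B → q i + η i j = q i' + η i' j'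

/-- The differences of heights depend only on the vertices of `f`. -/
def CompatibleHeights (f : Config V d N) (B : Set V) (η : Fin N → Fin (d + 1) → ℤ) : Prop :=
  ∀ i j k i' j' k', f i j ∈ B → f i k ∈ B → f i j = f i' j' → f i k = f i' k' →
    η i k - η i j = η i' k' - η i' j'

lemma Refines.of_map {h g : Config U d N} {f : Config V d N} {φ : U → U} (hg : Refines g f)
    (hφ : ∀ i j, g i j = φ (h i j)) : Refines h f := fun i j i' j' e =>
  hg i j i' j' (by rw [hφ, hφ, e])

variable [DecidableEq U]

/-- Simplices sharing a vertex lie in the same component of the dual graph. -/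
def VertexConnected (h : Config U d N) : Prop :=
  ∀ i j i' j', h i j = h i' j' → (dualGraph h).Reachable i i'

lemma IsBdryRidge.exists_cell {h : Config U d N} {R : Finset U} (hR : IsBdryRidge h R) :
    ∃ i, i ∈ cells h R ∧ ∀ v ∈ R, ∃ j, h i j = v := by
  obtain ⟨i, hi⟩ := Finset.card_eq_one.1 hR.2
  have hm : i ∈ cells h R := by simp [hi]
  refine ⟨i, hm, fun v hv => ?_⟩
  have := (Finset.mem_filter.1 hm).2 hv
  simpa [facet] using this

lemma HasPotential.lcStep {h g : Config U d N} {f : Config V d N} {B : Set V}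
    {η : Fin N → Fin (d + 1) → ℤ} (hη : CompatibleHeights f B η)
    (hB : ∀ i (T : Finset (Fin (d + 1))), (∀ j ∈ T, f i j ∉ B) → T.card < d - 1)
    (hg : Refines g f) (hs : LCStep h g) (hp : HasPotential h f B η) :
    HasPotential g f B η := by
  classical
  obtain ⟨R, S, hR, hS, -, hc, φ, hfix, hinj, him, hφ⟩ := hs
  have hh : Refines h f := hg.of_map hφ
  obtain ⟨q, hq⟩ := hp
  obtain ⟨r, -, hr⟩ := hR.exists_cell
  obtain ⟨s, -, hs⟩ := hS.exists_cell
  obtain ⟨w, hw, hwB⟩ : ∃ w, h r w ∈ R ∩ S ∧ f r w ∈ B := by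
    by_contra! hcon
    have h1 := hB r (univ.filter fun j => h r j ∈ R ∩ S) (fun j hj => hcon j (by simpa using hj))
    have h2 : R ∩ S ⊆ (univ.filter fun j => h r j ∈ R ∩ S).image (h r) := by
      intro v hv
      obtain ⟨j, rfl⟩ := hr v (Finset.mem_inter.1 hv).1
      exact Finset.mem_image_of_mem _ (by simpa using hv)
    have h3 := (Finset.card_le_card h2).trans Finset.card_image_le
    omega
  obtain ⟨w', hw'⟩ := hs _ (Finset.mem_inter.1 hw).2
  have key : ∀ i j i' j', h i j ∈ R → h i' j' ∉ R → g i j = g i' j' → f i j ∈ B →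
      q i + η i j = q i' + η i' j' := by
    intro i j i' j' hj hj' e hf
    have hmem : h i' j' ∈ S := by
      rw [← hfix _ hj', ← hφ, ← e, hφ, ← him]
      exact Finset.mem_image_of_mem _ hj
    obtain ⟨k, hk⟩ := hr _ hj
    obtain ⟨k', hk'⟩ := hs _ hmem
    have e1 := hq _ _ _ _ hk (by rwa [hh _ _ _ _ hk])
    have e2 := hq _ _ _ _ hk' (by rwa [hh _ _ _ _ hk', ← hg _ _ _ _ e])
    have e3 := hq _ _ _ _ hw'.symm hwB
    have e4 := hη r w k s w' k' hwB (by rwa [hh _ _ _ _ hk]) (hh _ _ _ _ hw'.symm)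
      (by rw [hh _ _ _ _ hk, hh _ _ _ _ hk', hg _ _ _ _ e])
    omega
  refine ⟨q, fun i j i' j' e hf => ?_⟩
  by_cases hj : h i j ∈ R <;> by_cases hj' : h i' j' ∈ R
  · exact hq _ _ _ _ (hinj hj hj' (by rw [← hφ, ← hφ, e])) hf
  · exact key _ _ _ _ hj hj' e hf
  · exact (key _ _ _ _ hj' hj e.symm (hg _ _ _ _ e ▸ hf)).symm
  · rw [hφ, hφ, hfix _ hj, hfix _ hj'] at e
    exact hq _ _ _ _ e hf

lemma dualGraph_mono {h g : Config U d N} {φ : U → U} (hφ : ∀ i j, g i j = φ (h i j))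
    (hg : Proper g) : dualGraph h ≤ dualGraph g := by
  have himg : ∀ i (R : Finset U), R ⊆ facet h i → R.image φ ⊆ facet g i ∧
      (R.image φ).card = R.card := by
    intro i R hR
    have hR' : ∀ v ∈ R, ∃ j, h i j = v := fun v hv => by simpa [facet] using hR hv
    constructor
    · intro v hv
      obtain ⟨u, hu, rfl⟩ := Finset.mem_image.1 hv
      obtain ⟨j, rfl⟩ := hR' u hu
      exact Finset.mem_image.2 ⟨j, Finset.mem_univ _, hφ i j⟩
    · refine Finset.card_image_of_injOn fun u hu v hv e => ?_
      obtain ⟨j, rfl⟩ := hR' u hu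
      obtain ⟨k, rfl⟩ := hR' v hv
      rw [hg i ((hφ i j).trans (e.trans (hφ i k).symm))]
  intro i i' hadj
  simp only [dualGraph, SimpleGraph.fromRel_adj] at hadj ⊢
  refine ⟨hadj.1, ?_⟩
  rcases hadj.2 with ⟨R, hc, h1, h2⟩ | ⟨R, hc, h1, h2⟩
  · exact .inl ⟨R.image φ, (himg _ _ h1).2.trans hc, (himg _ _ h1).1, (himg _ _ h2).1⟩
  · exact .inr ⟨R.image φ, (himg _ _ h1).2.trans hc, (himg _ _ h1).1, (himg _ _ h2).1⟩

lemma VertexConnected.uniteStep {h g : Config U d N} (hg : Proper g) (hs : UniteStep h g)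
    (hc : VertexConnected h) : VertexConnected g := by
  obtain ⟨R, S, hR, hS, hd, hne, φ, hfix, hinj, him, hφ⟩ := hs
  obtain ⟨r, hrc, hr⟩ := hR.exists_cell
  obtain ⟨s, hsc, hs⟩ := hS.exists_cell
  have mono := dualGraph_mono hφ hg
  have hrs : (dualGraph g).Reachable r s := by
    refine SimpleGraph.Adj.reachable ?_
    simp only [dualGraph, SimpleGraph.fromRel_adj]
    refine ⟨fun e => hne r hrc s hsc (e ▸ SimpleGraph.Reachable.refl _),
      .inl ⟨S, hS.1, fun v hv => ?_, fun v hv => ?_⟩⟩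
    · rw [← him] at hv
      obtain ⟨u, hu, rfl⟩ := Finset.mem_image.1 hv
      obtain ⟨j, rfl⟩ := hr u hu
      exact Finset.mem_image.2 ⟨j, Finset.mem_univ _, hφ r j⟩
    · obtain ⟨j, rfl⟩ := hs v hv
      exact Finset.mem_image.2 ⟨j, Finset.mem_univ _,
        (hφ s j).trans (hfix _ (Finset.disjoint_right.1 hd hv))⟩
  have key : ∀ i j i' j', h i j ∈ R → h i' j' ∉ R → g i j = g i' j' →
      (dualGraph g).Reachable i i' := by
    intro i j i' j' hj hj' e
    have hmem : h i' j' ∈ S := by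
      rw [← hfix _ hj', ← hφ, ← e, hφ, ← him]
      exact Finset.mem_image_of_mem _ hj
    obtain ⟨k, hk⟩ := hr _ hj
    obtain ⟨k', hk'⟩ := hs _ hmem
    exact ((hc _ _ _ _ hk.symm).mono mono).trans (hrs.trans ((hc _ _ _ _ hk').mono mono))
  intro i j i' j' e
  by_cases hj : h i j ∈ R <;> by_cases hj' : h i' j' ∈ R
  · exact (hc _ _ _ _ (hinj hj hj' (by rw [← hφ, ← hφ, e]))).mono mono
  · exact key _ _ _ _ hj hj' e
  · exact (key _ _ _ _ hj' hj e.symm).symm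
  · rw [hφ, hφ, hfix _ hj, hfix _ hj'] at e
    exact (hc _ _ _ _ e).mono mono

lemma HasPotential.uniteStep {h g : Config U d N} {f : Config V d N} {B : Set V}
    {η : Fin N → Fin (d + 1) → ℤ} (hη : CompatibleHeights f B η)
    (hg : Refines g f) (hs : UniteStep h g) (hc : VertexConnected h)
    (hp : HasPotential h f B η) : HasPotential g f B η := by
  classical
  obtain ⟨R, S, hR, hS, -, hne, φ, hfix, hinj, him, hφ⟩ := hs
  have hh : Refines h f := hg.of_map hφ
  obtain ⟨q, hq⟩ := hp
  obtain ⟨r, hrc, hr⟩ := hR.exists_cell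
  obtain ⟨s, hsc, hs⟩ := hS.exists_cell
  have hnrs := hne r hrc s hsc
  obtain ⟨δ, hδ⟩ : ∃ δ : ℤ, ∀ k k', f r k ∈ B → g r k = g s k' →
      q r + δ + η r k = q s + η s k' := by
    by_cases hex : ∃ k k', f r k ∈ B ∧ g r k = g s k'
    · obtain ⟨l, l', hl, e⟩ := hex
      refine ⟨q s + η s l' - q r - η r l, fun k k' hk e' => ?_⟩
      have := hη r l k s l' k' hl hk (hg _ _ _ _ e) (hg _ _ _ _ e')
      omega
    · exact ⟨0, fun k k' hk e => (hex ⟨k, k', hk, e⟩).elim⟩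
  have key : ∀ i j i' j', h i j ∈ R → h i' j' ∉ R → g i j = g i' j' → f i j ∈ B →
      (q i + if (dualGraph h).Reachable r i then δ else 0) + η i j =
        (q i' + if (dualGraph h).Reachable r i' then δ else 0) + η i' j' := by
    intro i j i' j' hj hj' e hf
    have hmem : h i' j' ∈ S := by
      rw [← hfix _ hj', ← hφ, ← e, hφ, ← him]
      exact Finset.mem_image_of_mem _ hj
    obtain ⟨k, hk⟩ := hr _ hj
    obtain ⟨k', hk'⟩ := hs _ hmem
    have hkB : f r k ∈ B := by rwa [hh _ _ _ _ hk]
    rw [if_pos (hc _ _ _ _ hk), if_neg fun hri' => hnrs (hri'.trans (hc _ _ _ _ hk').symm)]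
    have e1 := hq _ _ _ _ hk hkB
    have e2 := hq _ _ _ _ hk' (by rwa [hh _ _ _ _ hk', ← hg _ _ _ _ e])
    have e3 := hδ k k' hkB (by rw [hφ, hφ, hk, hk', ← hφ, ← hφ, e])
    omega
  have same : ∀ i j i' j', h i j = h i' j' → f i j ∈ B →
      (q i + if (dualGraph h).Reachable r i then δ else 0) + η i j =
        (q i' + if (dualGraph h).Reachable r i' then δ else 0) + η i' j' := by
    intro i j i' j' e hf
    have hiff : (dualGraph h).Reachable r i ↔ (dualGraph h).Reachable r i' :=
      ⟨fun H => H.trans (hc _ _ _ _ e), fun H => H.trans (hc _ _ _ _ e).symm⟩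
    have e1 := hq _ _ _ _ e hf
    simp only [hiff]
    omega
  refine ⟨fun i => q i + if (dualGraph h).Reachable r i then δ else 0,
    fun i j i' j' e hf => ?_⟩
  by_cases hj : h i j ∈ R <;> by_cases hj' : h i' j' ∈ R
  · exact same _ _ _ _ (hinj hj hj' (by rw [← hφ, ← hφ, e])) hf
  · exact key _ _ _ _ hj hj' e hf
  · exact (key _ _ _ _ hj' hj e.symm (hg _ _ _ _ e ▸ hf)).symm
  · rw [hφ, hφ, hfix _ hj, hfix _ hj'] at e
    exact same _ _ _ _ e hf

/-- In an LC configuration, compatible heights always come from a global potential, provided every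
`(d-2)`-face meets the vertex set on which the heights are considered. -/
theorem IsLC.hasPotential {f : Config V d N} {B : Set V} {η : Fin N → Fin (d + 1) → ℤ}
    (hf : Proper f) (hη : CompatibleHeights f B η)
    (hB : ∀ i (T : Finset (Fin (d + 1))), (∀ j ∈ T, f i j ∉ B) → T.card < d - 1)
    (h : IsLC f) : HasPotential f f B η := by
  obtain ⟨t, g, ⟨ht, -⟩, hg, e, he, hfe⟩ := h
  have hgf : Refines g f := fun i j i' j' h => by rw [hfe, hfe, h]
  have proper_of : ∀ k : Config (Fin N × Fin (d + 1)) d N, Refines k f → Proper k :=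
    fun k hk i j j' h => hf i (hk _ _ _ _ h)
  have tree : ∀ k, Relation.ReflTransGen UniteStep (std d N) k → Refines k f →
      VertexConnected k ∧ HasPotential k f B η := by
    intro k hk
    induction hk with
    | refl =>
      intro _
      refine ⟨fun i j i' j' h => ?_, 0, fun i j i' j' h _ => ?_⟩
      · obtain rfl : i = i' := (Prod.ext_iff.1 h).1
        exact SimpleGraph.Reachable.refl _
      · obtain ⟨rfl, rfl⟩ := Prod.ext_iff.1 h
        rfl
    | tail _ hs ih =>
      intro hk
      obtain ⟨R, S, -, -, -, -, φ, -, -, -, hφ⟩ := id hs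
      obtain ⟨h1, h2⟩ := ih (hk.of_map hφ)
      exact ⟨h1.uniteStep (proper_of _ hk) hs, h2.uniteStep hη hk hs h1⟩
  have lc : ∀ k, Relation.ReflTransGen LCStep t k → Refines k f → HasPotential k f B η := by
    intro k hk
    induction hk with
    | refl => exact fun h => (tree t ht h).2
    | tail _ hs ih =>
      intro hk
      obtain ⟨R, S, -, -, -, -, φ, -, -, -, hφ⟩ := id hs
      exact (ih (hk.of_map hφ)).lcStep hη hB hk hs
  obtain ⟨q, hq⟩ := lc g hg hgf
  refine ⟨q, fun i j i' j' h => hq i j i' j' (he ⟨i, j, rfl⟩ ⟨i', j', rfl⟩ ?_)⟩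
  rw [← hfe, ← hfe, h]

end Obstruction

section Relabel

variable {U V : Type*} {d N : ℕ}

lemma IsLC.relabel {f : Config V d N} (e : V → U) (he : Function.Injective e) (h : IsLC f) :
    IsLC fun i j => e (f i j) := by
  obtain ⟨t, g, ht, hg, e', he', hf⟩ := h
  exact ⟨t, g, ht, hg, e ∘ e', he.comp_injOn he', fun i j => congrArg e (hf i j)⟩

lemma IsMogami.relabel {f : Config V d N} (e : V → U) (he : Function.Injective e)
    (h : IsMogami f) : IsMogami fun i j => e (f i j) := by
  obtain ⟨t, g, ht, hg, e', he', hf⟩ := h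
  exact ⟨t, g, ht, hg, e ∘ e', he.comp_injOn he', fun i j => congrArg e (hf i j)⟩

lemma IsPseudo.relabel [DecidableEq U] [DecidableEq V] {f : Config V d N} (e : V ≃ U)
    (h : IsPseudo f) : IsPseudo fun i j => e (f i j) := by
  refine ⟨fun i => e.injective.comp (h.1 i), fun R hR => ?_⟩
  have hcard : (R.image e.symm).card = d := by
    rw [Finset.card_image_of_injective _ e.symm.injective, hR]
  refine (Finset.card_le_card fun i hi => ?_).trans (h.2 _ hcard)
  simp only [cells, Finset.mem_filter, Finset.mem_univ, true_and] at hi ⊢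
  intro v hv
  obtain ⟨u, hu, rfl⟩ := Finset.mem_image.1 hv
  obtain ⟨j, -, hj⟩ := Finset.mem_image.1 (hi hu)
  exact Finset.mem_image.2 ⟨j, Finset.mem_univ _, by simp [← hj]⟩

end Relabel

section Strip

variable {V : Type*} [DecidableEq V] {d N : ℕ}

/-- The first `k + 1` simplices are placed as in `T`, the others are still disjoint. -/
def partialTree (T : Config (Fin N × Fin (d + 1)) d N) (k : ℕ) :
    Config (Fin N × Fin (d + 1)) d N :=
  fun i j => if i.val ≤ k then T i j else (i, j)

/-- A linear strip of simplices: the simplex `i + 1` is attached to the simplex `i`, along the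
facet opposite to its vertex in position `a`, which is the only new vertex. -/
structure IsStrip (T : Config (Fin N × Fin (d + 1)) d N) (a : Fin (d + 1)) : Prop where
  proper : Proper T
  fst_le : ∀ i j, (T i j).1 ≤ i
  zero : ∀ i j, i.val = 0 → T i j = (i, j)
  new : ∀ i, T i a = (i, a)
  attach : ∀ i i' : Fin N, i'.val = i.val + 1 → ∀ j, j ≠ a → ∃ k, T i' j = T i k
  last : ∀ i i' : Fin N, i'.val = i.val + 1 → ∃ j, j ≠ a ∧ T i' j = (i, a)

lemma isBdryRidge_image {h : Config V d N} {i : Fin N} {a : Fin (d + 1)} (k : Fin N)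
    (hi : Function.Injective (h i)) (hk : ∀ j, j ≠ a → ∃ j', h k j' = h i j)
    (huniq : ∃ j, j ≠ a ∧ ∀ l m, h l m = h i j → l = k) :
    IsBdryRidge h ((univ.erase a).image (h i)) := by
  refine ⟨by simp [Finset.card_image_of_injective _ hi], Finset.card_eq_one.2 ⟨k, ?_⟩⟩
  ext l
  simp only [cells, Finset.mem_filter, Finset.mem_univ, true_and, Finset.mem_singleton]
  constructor
  · intro hl
    obtain ⟨j, hj, hu⟩ := huniq
    obtain ⟨m, -, hm⟩ := Finset.mem_image.1 (hl (Finset.mem_image_of_mem _ (by simpa using hj)))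
    exact hu l m hm
  · rintro rfl v hv
    obtain ⟨j, hj, rfl⟩ := Finset.mem_image.1 hv
    obtain ⟨j', hj'⟩ := hk j (by simpa using hj)
    exact Finset.mem_image.2 ⟨j', Finset.mem_univ _, hj'⟩

lemma not_reachable_of_isolated {h : Config V d N} (hd : d ≠ 0) {r s : Fin N} (hrs : r ≠ s)
    (hr : ∀ i j k, h r j = h i k → i = r) : ¬ (dualGraph h).Reachable r s := by
  rintro ⟨w⟩
  cases w with
  | nil => exact hrs rfl
  | @cons _ i _ hadj _ =>
    simp only [dualGraph, SimpleGraph.fromRel_adj] at hadj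
    obtain ⟨hne, hadj⟩ := hadj
    have : ∃ R : Finset V, R.card = d ∧ R ⊆ facet h r ∧ R ⊆ facet h i := by
      rcases hadj with ⟨R, h1, h2, h3⟩ | ⟨R, h1, h2, h3⟩
      exacts [⟨R, h1, h2, h3⟩, ⟨R, h1, h3, h2⟩]
    obtain ⟨R, hc, h1, h2⟩ := this
    obtain ⟨v, hv⟩ := Finset.card_pos.1 (by omega : 0 < R.card)
    obtain ⟨j, -, hj⟩ := Finset.mem_image.1 (h1 hv)
    obtain ⟨k, -, hk⟩ := Finset.mem_image.1 (h2 hv)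
    exact hne (hr i j k (hj.trans hk.symm)).symm

variable {T : Config (Fin N × Fin (d + 1)) d N} {a : Fin (d + 1)}

lemma IsStrip.uniteStep (hT : IsStrip T a) (hd : d ≠ 0) {k : ℕ} (hk : k + 1 < N) :
    UniteStep (partialTree T k) (partialTree T (k + 1)) := by
  set r : Fin N := ⟨k + 1, hk⟩ with hr
  set s : Fin N := ⟨k, by omega⟩ with hs
  have hrs : r.val = s.val + 1 := rfl
  have hPr : ∀ j, partialTree T k r j = (r, j) := fun j => if_neg (by simp [hr])
  have hPs : ∀ j, partialTree T k s j = T s j := fun j => if_pos (by simp [hs])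
  have hPle : ∀ i j, (partialTree T k i j).1 ≤ i := by
    intro i j
    unfold partialTree
    split_ifs
    exacts [hT.fst_le i j, le_rfl]
  have hPlt : ∀ i j, i ≠ r → (partialTree T k i j).1 ≠ r := by
    intro i j hi e
    unfold partialTree at e
    split_ifs at e with h
    · have := hT.fst_le i j
      rw [e, Fin.le_def] at this
      simp only [hr] at this
      omega
    · exact hi e
  have hiso : ∀ i j m, partialTree T k r j = partialTree T k i m → i = r := by
    intro i j m e
    by_contra hi
    exact hPlt i m hi (by rw [← e, hPr])
  obtain ⟨b, hb, hTb⟩ := hT.last s r hrs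
  have hR : IsBdryRidge (partialTree T k) ((univ.erase a).image (partialTree T k r)) :=
    isBdryRidge_image r (fun j j' e => by simpa [hPr] using e) (fun j _ => ⟨j, rfl⟩)
      ⟨b, hb, fun l m e => hiso l b m e.symm⟩
  have hsub : ∀ j, j ≠ a → ∃ m, partialTree T k s m = T r j := fun j hj => by
    obtain ⟨m, hm⟩ := hT.attach s r hrs j hj
    exact ⟨m, by rw [hPs, hm]⟩
  have hS : IsBdryRidge (partialTree T k) ((univ.erase a).image (T r)) := by
    refine ⟨by simp [Finset.card_image_of_injective _ (hT.proper r)],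
      Finset.card_eq_one.2 ⟨s, ?_⟩⟩
    ext l
    simp only [cells, Finset.mem_filter, Finset.mem_univ, true_and, Finset.mem_singleton]
    constructor
    · intro hl
      obtain ⟨m, -, hm⟩ := Finset.mem_image.1
        (hl (Finset.mem_image_of_mem _ (by simpa using hb : b ∈ univ.erase a)))
      rw [hTb] at hm
      have h1 := hPle l m
      rw [hm, Fin.le_def] at h1
      by_contra hne
      have h2 : ¬ l.val ≤ k := fun h => hne (Fin.ext (le_antisymm h h1))
      rw [partialTree, if_neg h2] at hm
      exact hne (Prod.ext_iff.1 hm).1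
    · rintro rfl v hv
      obtain ⟨j, hj, rfl⟩ := Finset.mem_image.1 hv
      obtain ⟨m, hm⟩ := hsub j (by simpa using hj)
      exact Finset.mem_image.2 ⟨m, Finset.mem_univ _, hm⟩
  have hTr : ∀ j, j ≠ a → (T r j).1 ≠ r := by
    intro j hj e
    obtain ⟨m, hm⟩ := hsub j hj
    exact hPlt s m (fun h => by simp [hr, hs] at h) (by rw [hm, e])
  refine ⟨_, _, hR, hS, ?_, ?_, fun v => if v.1 = r ∧ v.2 ≠ a then T r v.2 else v,
    ?_, ?_, ?_, ?_⟩
  · rw [Finset.disjoint_left]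
    intro v hv hv'
    obtain ⟨j, hj, rfl⟩ := Finset.mem_image.1 hv
    obtain ⟨j', hj', e⟩ := Finset.mem_image.1 hv'
    exact hTr j' (by simpa using hj') (by rw [e, hPr])
  · intro i hi i' hi'
    have hcell : ∀ l ∈ cells (partialTree T k) ((univ.erase a).image (partialTree T k r)),
        l = r := by
      intro l hl
      obtain ⟨m, -, hm⟩ := Finset.mem_image.1 ((Finset.mem_filter.1 hl).2
        (Finset.mem_image_of_mem _ (by simpa using hb : b ∈ univ.erase a)))
      exact hiso l b m hm.symm
    obtain rfl := hcell i hi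
    refine not_reachable_of_isolated hd ?_ hiso
    rintro rfl
    obtain ⟨m, -, hm⟩ := Finset.mem_image.1 ((Finset.mem_filter.1 hi').2
      (Finset.mem_image_of_mem _ (by simpa using hb : b ∈ univ.erase a)))
    rw [hPr] at hm
    exact hTr b hb (by rw [← hm])
  · intro v hv
    refine if_neg fun h => hv (Finset.mem_image.2 ⟨v.2, by simpa using h.2, ?_⟩)
    rw [hPr, ← h.1]
  · intro v hv w hw e
    obtain ⟨j, hj, rfl⟩ := Finset.mem_image.1 hv
    obtain ⟨j', hj', rfl⟩ := Finset.mem_image.1 hw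
    simp only [Finset.mem_erase, Finset.mem_univ, and_true] at hj hj'
    simp only [hPr, hj, hj', ne_eq, not_false_eq_true, and_self, if_true] at e ⊢
    rw [hT.proper r e]
  · rw [Finset.image_image]
    refine Finset.image_congr fun j hj => ?_
    have hj' : j ≠ a := by simpa using hj
    simp [hPr, hj']
  · intro i j
    by_cases hi : i = r
    · rw [hi, hPr]
      by_cases hj : j = a
      · simp [partialTree, hr, hj, hT.new]
      · simp [partialTree, hr, hj]
    · refine Eq.trans ?_ (if_neg fun h => hPlt i j hi h.1).symm
      have : i.val ≤ k + 1 ↔ i.val ≤ k := by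
        have : i.val ≠ k + 1 := fun h => hi (Fin.ext h)
        omega
      simp [partialTree, this]

lemma IsStrip.isTreeOfSimplicesC (hT : IsStrip T a) (hd : d ≠ 0) (hN : 0 < N) :
    IsTreeOfSimplicesC T := by
  constructor
  · have hstage : ∀ k, k < N →
        Relation.ReflTransGen UniteStep (std d N) (partialTree T k) := by
      intro k
      induction k with
      | zero =>
        intro _
        have : partialTree T 0 = std d N := by
          funext i j
          unfold partialTree std
          split_ifs with h
          exacts [hT.zero i j (by omega), rfl]
        rw [this]
      | succ k ih => exact fun hk => (ih (by omega)).tail (hT.uniteStep hd hk)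
    have : partialTree T (N - 1) = T := by
      funext i j
      exact if_pos (by omega)
    exact this ▸ hstage (N - 1) (by omega)
  · have hreach : ∀ n (hn : n < N), (dualGraph T).Reachable ⟨0, hN⟩ ⟨n, hn⟩ := by
      intro n
      induction n with
      | zero => exact fun _ => SimpleGraph.Reachable.refl _
      | succ n ih =>
        intro hn
        refine (ih (by omega)).trans (SimpleGraph.Adj.reachable ?_)
        simp only [dualGraph, SimpleGraph.fromRel_adj]
        refine ⟨by simp, .inl ⟨(univ.erase a).image (T ⟨n + 1, hn⟩),
          by simp [Finset.card_image_of_injective _ (hT.proper _)], fun v hv => ?_,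
          fun v hv => ?_⟩⟩
        · obtain ⟨j, hj, rfl⟩ := Finset.mem_image.1 hv
          obtain ⟨m, hm⟩ := hT.attach ⟨n, by omega⟩ ⟨n + 1, hn⟩ rfl j (by simpa using hj)
          exact Finset.mem_image.2 ⟨m, Finset.mem_univ _, hm.symm⟩
        · obtain ⟨j, -, rfl⟩ := Finset.mem_image.1 hv
          exact Finset.mem_image.2 ⟨j, Finset.mem_univ _, rfl⟩
    have : Nonempty (Fin N) := ⟨⟨0, hN⟩⟩
    exact ⟨fun i j => (hreach i i.2).symm.trans (hreach j j.2)⟩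

end Strip

section ConeOverBand

/-- The iterated cone, with `m + 1` apices, over the five-vertex Möbius band with triangles
`{i, i + 1, i + 2}`, `i ∈ ℤ/5`. -/
def bandCone (m : ℕ) : Config (Fin 5 ⊕ Fin (m + 3 + 1)) (m + 3) 5 := fun i j =>
  if j.val < 3 then .inl ⟨(i.val + j.val) % 5, by omega⟩ else .inr j

/-- The same cone over the strip obtained by cutting the band open along an edge. -/
def stripCone (m : ℕ) : Config (Fin 5 × Fin (m + 3 + 1)) (m + 3) 5 := fun i j =>
  if h0 : 3 ≤ j.val then (0, j)
  else if h : i.val + j.val ≤ 2 then (0, ⟨i.val + j.val, by omega⟩)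
  else (⟨i.val + j.val - 2, by omega⟩, ⟨2, by omega⟩)

variable {m : ℕ}

lemma bandCone_proper : Proper (bandCone m) := by
  intro i j j' h
  unfold bandCone at h
  split_ifs at h with h1 h2 h2
  · simp only [Sum.inl.injEq, Fin.mk.injEq] at h
    exact Fin.ext (by omega)
  · exact Sum.inr.inj h

lemma card_le_of_three_le (T : Finset (Fin (m + 3 + 1))) (hT : ∀ j ∈ T, 3 ≤ j.val) :
    T.card ≤ m + 1 := by
  have := Finset.card_le_card_of_injOn (s := T) (t := Finset.range (m + 1))
    (fun j => j.val - 3)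
    (fun j hj => by
      have := hT j hj
      have := j.2
      simp only [Finset.coe_range, Set.mem_Iio]
      omega)
    (fun j hj k hk e => by
      have := hT j hj
      have := hT k hk
      simp only at e
      exact Fin.ext (by omega))
  simpa using this

lemma band_pseudo : ∀ A : Finset (Fin 5), 2 ≤ A.card →
    (univ.filter fun i : Fin 5 => A ⊆ {i, i + 1, i + 2}).card ≤ 2 := by
  decide

lemma bandCone_isPseudo : IsPseudo (bandCone m) := by
  refine ⟨bandCone_proper, fun R hR => ?_⟩
  rcases (cells (bandCone m) R).eq_empty_or_nonempty with h0 | ⟨i, hi⟩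
  · simp [h0]
  set A : Finset (Fin 5) := univ.filter fun x => Sum.inl x ∈ R with hA
  have hcard : R.card ≤ A.card + (m + 1) := by
    have hsub : R ⊆ A.image Sum.inl ∪
        (univ.filter fun j : Fin (m + 3 + 1) => 3 ≤ j.val).image Sum.inr := by
      intro v hv
      obtain ⟨j, -, rfl⟩ := Finset.mem_image.1 ((Finset.mem_filter.1 hi).2 hv)
      unfold bandCone at hv ⊢
      split_ifs at hv ⊢ with h
      · exact Finset.mem_union_left _ (Finset.mem_image_of_mem _ (by simpa [hA] using hv))
      · exact Finset.mem_union_right _ (Finset.mem_image_of_mem _ (by simp; omega))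
    refine (Finset.card_le_card hsub).trans ((Finset.card_union_le _ _).trans ?_)
    exact add_le_add Finset.card_image_le
      (Finset.card_image_le.trans (card_le_of_three_le _ (by simp)))
  refine (Finset.card_le_card fun l hl => ?_).trans (band_pseudo A (by omega))
  simp only [Finset.mem_filter, Finset.mem_univ, true_and]
  intro x hx
  obtain ⟨j, -, hj⟩ := Finset.mem_image.1
    ((Finset.mem_filter.1 hl).2 (by simpa [hA] using hx : Sum.inl x ∈ R))
  unfold bandCone at hj
  split_ifs at hj with h
  simp only [Sum.inl.injEq] at hj
  subst hj
  simp only [Finset.mem_insert, Finset.mem_singleton, Fin.ext_iff, Fin.val_add]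
  have : (1 : Fin 5).val = 1 := rfl
  have : (2 : Fin 5).val = 2 := rfl
  omega

lemma bandCone_not_isLC : ¬ IsLC (bandCone m) := by
  intro h
  have hin : ∀ i j, bandCone m i j ∈ Set.range (Sum.inl : Fin 5 → _) → j.val < 3 := by
    intro i j hj
    by_contra h
    simp [bandCone, h] at hj
  have hmod : ∀ i j i' j', bandCone m i j ∈ Set.range (Sum.inl : Fin 5 → _) →
      bandCone m i j = bandCone m i' j' →
      j.val < 3 ∧ j'.val < 3 ∧ (i.val + j.val) % 5 = (i'.val + j'.val) % 5 := by
    intro i j i' j' hj e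
    have h1 := hin i j hj
    have h2 := hin i' j' (e ▸ hj)
    simpa [bandCone, h1, h2] using e
  obtain ⟨q, hq⟩ := h.hasPotential (B := Set.range Sum.inl) (η := fun _ j => (j.val : ℤ))
    bandCone_proper
    (by
      intro i j k i' j' k' hj hk ej ek
      have := hmod _ _ _ _ hj ej
      have := hmod _ _ _ _ hk ek
      simp only
      omega)
    (by
      intro i T hT
      have := card_le_of_three_le T fun j hj => by
        by_contra h
        exact hT j hj (by simp [bandCone, not_le.1 h])
      omega)
  have step : ∀ i i' : Fin 5, (i.val + 1) % 5 = i'.val → q i + 1 = q i' := by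
    intro i i' e
    have := hq i ⟨1, by omega⟩ i' ⟨0, by omega⟩
      (by simp [bandCone, e, Nat.mod_eq_of_lt i'.2]) (by simp [bandCone])
    simpa using this
  have h0 := step 0 1 rfl
  have h1 := step 1 2 rfl
  have h2 := step 2 3 rfl
  have h3 := step 3 4 rfl
  have h4 := step 4 0 rfl
  omega

lemma corner_ext_iff {a b : ℕ} {x y : Fin a × Fin b} :
    x = y ↔ x.1.val = y.1.val ∧ x.2.val = y.2.val := by
  rw [Prod.ext_iff, Fin.ext_iff, Fin.ext_iff]

lemma stripCone_fst (i : Fin 5) (j : Fin (m + 3 + 1)) :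
    (stripCone m i j).1.val = if 3 ≤ j.val then 0 else i.val + j.val - 2 := by
  unfold stripCone
  split_ifs with h h'
  · rfl
  · exact (Nat.sub_eq_zero_of_le h').symm
  · rfl

lemma stripCone_snd (i : Fin 5) (j : Fin (m + 3 + 1)) :
    (stripCone m i j).2.val = if 3 ≤ j.val then j.val else min (i.val + j.val) 2 := by
  unfold stripCone
  split_ifs with h h'
  · rfl
  · exact (min_eq_left h').symm
  · exact (min_eq_right (not_le.1 h').le).symm

lemma stripCone_isStrip : IsStrip (stripCone m) ⟨2, by omega⟩ where
  proper i j j' h := by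
    rw [corner_ext_iff, stripCone_fst, stripCone_fst, stripCone_snd, stripCone_snd] at h
    split_ifs at h <;> exact Fin.ext (by omega)
  fst_le i j := by
    rw [Fin.le_def, stripCone_fst]
    split_ifs <;> omega
  zero i j hi := by
    rw [corner_ext_iff, stripCone_fst, stripCone_snd]
    dsimp only
    split_ifs <;> omega
  new i := by
    rw [corner_ext_iff, stripCone_fst, stripCone_snd]
    dsimp only
    split_ifs <;> omega
  attach i i' hi j hj := by
    have hj' : j.val ≠ 2 := fun h => hj (Fin.ext h)
    by_cases h : 3 ≤ j.val
    · exact ⟨j, by simp [stripCone, h]⟩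
    · refine ⟨⟨j.val + 1, by omega⟩, ?_⟩
      rw [corner_ext_iff, stripCone_fst, stripCone_fst, stripCone_snd, stripCone_snd]
      dsimp only
      split_ifs <;> omega
  last i i' hi := by
    refine ⟨⟨1, by omega⟩, by simp, ?_⟩
    rw [corner_ext_iff, stripCone_fst, stripCone_snd]
    dsimp only
    split_ifs <;> omega

/-- The identification of the two end edges of the strip. -/
def closeStrip (m : ℕ) (v : Fin 5 × Fin (m + 3 + 1)) : Fin 5 × Fin (m + 3 + 1) :=
  if v.2.val = 2 ∧ 3 ≤ v.1.val then (0, ⟨v.1.val - 3, by omega⟩) else v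

lemma closeStrip_fst (v : Fin 5 × Fin (m + 3 + 1)) :
    (closeStrip m v).1.val = if v.2.val = 2 ∧ 3 ≤ v.1.val then 0 else v.1.val := by
  unfold closeStrip
  split_ifs <;> rfl

lemma closeStrip_snd (v : Fin 5 × Fin (m + 3 + 1)) :
    (closeStrip m v).2.val = if v.2.val = 2 ∧ 3 ≤ v.1.val then v.1.val - 3 else v.2.val := by
  unfold closeStrip
  split_ifs <;> rfl

lemma mogamiStep_closeStrip :
    MogamiStep (stripCone m) fun i j => closeStrip m (stripCone m i j) := by
  have hR : IsBdryRidge (stripCone m) ((univ.erase ⟨0, by omega⟩).image (stripCone m 4)) := by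
    refine isBdryRidge_image 4 (stripCone_isStrip.proper 4) (fun j _ => ⟨j, rfl⟩)
      ⟨⟨2, by omega⟩, by simp, fun l k e => Fin.ext ?_⟩
    rw [corner_ext_iff, stripCone_fst, stripCone_fst] at e
    dsimp only at e
    split_ifs at e <;> omega
  have hS : IsBdryRidge (stripCone m) ((univ.erase ⟨2, by omega⟩).image (stripCone m 0)) := by
    refine isBdryRidge_image 0 (stripCone_isStrip.proper 0) (fun j _ => ⟨j, rfl⟩)
      ⟨⟨0, by omega⟩, by simp, fun l k e => Fin.ext ?_⟩
    rw [corner_ext_iff, stripCone_fst, stripCone_fst, stripCone_snd, stripCone_snd] at e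
    dsimp only at e
    split_ifs at e <;> omega
  refine ⟨_, _, hR, hS, ?_, ?_, closeStrip m, ?_, ?_, ?_, fun _ _ => rfl⟩
  · intro e
    have hmem : stripCone m 4 ⟨2, by omega⟩ ∈
        (univ.erase ⟨2, by omega⟩).image (stripCone m 0) := by
      rw [← e]
      exact Finset.mem_image_of_mem _ (by simp)
    obtain ⟨j, -, hj⟩ := Finset.mem_image.1 hmem
    rw [corner_ext_iff, stripCone_fst, stripCone_fst] at hj
    dsimp only at hj
    split_ifs at hj <;> omega
  · refine Finset.card_pos.2 ⟨(0, ⟨3, by omega⟩), Finset.mem_inter.2 ⟨?_, ?_⟩⟩ <;>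
      exact Finset.mem_image.2 ⟨⟨3, by omega⟩, by simp, by simp [stripCone]⟩
  · intro v hv
    refine if_neg fun h => hv (Finset.mem_image.2 ⟨⟨v.1.val - 2, by omega⟩, ?_, ?_⟩)
    · simp only [Finset.mem_erase, Finset.mem_univ, and_true, ne_eq, Fin.mk.injEq]
      omega
    · rw [corner_ext_iff, stripCone_fst, stripCone_snd]
      dsimp only
      split_ifs <;> omega
  · intro v hv w hw e
    obtain ⟨j, hj, rfl⟩ := Finset.mem_image.1 hv
    obtain ⟨k, hk, rfl⟩ := Finset.mem_image.1 hw
    have hj0 : j.val ≠ 0 := fun h => (Finset.mem_erase.1 hj).1 (Fin.ext h)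
    have hk0 : k.val ≠ 0 := fun h => (Finset.mem_erase.1 hk).1 (Fin.ext h)
    simp only [corner_ext_iff, closeStrip_fst, closeStrip_snd, stripCone_fst, stripCone_snd] at e ⊢
    grind
  · ext v
    constructor
    · intro hv
      obtain ⟨w, hw, rfl⟩ := Finset.mem_image.1 hv
      obtain ⟨j, hj, rfl⟩ := Finset.mem_image.1 hw
      have hj0 : j.val ≠ 0 := fun h => (Finset.mem_erase.1 hj).1 (Fin.ext h)
      refine Finset.mem_image.2 ⟨⟨if 3 ≤ j.val then j.val else j.val - 1, by split_ifs <;> omega⟩,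
        ?_, ?_⟩
      · simp only [Finset.mem_erase, Finset.mem_univ, and_true, ne_eq, Fin.mk.injEq]
        split_ifs <;> omega
      · simp only [corner_ext_iff, closeStrip_fst, closeStrip_snd, stripCone_fst, stripCone_snd]
        grind
    · intro hv
      obtain ⟨j, hj, rfl⟩ := Finset.mem_image.1 hv
      have hj2 : j.val ≠ 2 := fun h => (Finset.mem_erase.1 hj).1 (Fin.ext h)
      refine Finset.mem_image.2 ⟨_, Finset.mem_image_of_mem _ (a :=
        ⟨if 3 ≤ j.val then j.val else j.val + 1, by split_ifs <;> omega⟩) ?_, ?_⟩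
      · simp only [Finset.mem_erase, Finset.mem_univ, and_true, ne_eq, Fin.mk.injEq]
        grind
      · simp only [corner_ext_iff, closeStrip_fst, closeStrip_snd, stripCone_fst, stripCone_snd]
        grind

/-- The vertex of the cone over the band represented by a vertex of the closed strip. -/
def stripLabel (m : ℕ) (v : Fin 5 × Fin (m + 3 + 1)) : Fin 5 ⊕ Fin (m + 3 + 1) :=
  if v.2.val < 3 then .inl ⟨(v.1.val + v.2.val) % 5, by omega⟩ else .inr v.2

lemma represents_closeStrip :
    Represents (fun i j => closeStrip m (stripCone m i j)) (bandCone m) := by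
  refine ⟨stripLabel m, ?_, fun i j => ?_⟩
  · have hused : ∀ v ∈ {x | ∃ i j, closeStrip m (stripCone m i j) = x},
        v.1.val = 0 ∨ (v.1.val ≤ 2 ∧ v.2.val = 2) := by
      rintro _ ⟨i, j, rfl⟩
      rw [closeStrip_fst, closeStrip_snd, stripCone_fst, stripCone_snd]
      grind
    intro v hv w hw e
    have h1 := hused v hv
    have h2 := hused w hw
    unfold stripLabel at e
    rw [corner_ext_iff]
    split_ifs at e <;> simp only [Sum.inl.injEq, Sum.inr.injEq, Fin.ext_iff] at e <;> omega
  · have h1 := closeStrip_fst (stripCone m i j)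
    have h2 := closeStrip_snd (stripCone m i j)
    rw [stripCone_fst, stripCone_snd] at h1 h2
    unfold stripLabel bandCone
    by_cases hj : j.val < 3
    · have h3 : ¬ 3 ≤ j.val := by omega
      rw [if_neg h3, if_neg h3] at h1 h2
      have h4 : (closeStrip m (stripCone m i j)).2.val < 3 := by
        split_ifs at h2 <;> omega
      rw [if_pos hj, if_pos h4]
      simp only [Sum.inl.injEq, Fin.mk.injEq]
      split_ifs at h1 h2 <;> omega
    · have h3 : 3 ≤ j.val := by omega
      rw [if_pos h3, if_pos h3] at h1 h2
      rw [if_neg (by omega)] at h2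
      rw [if_neg hj, if_neg (by dsimp only; omega)]
      exact congrArg Sum.inr (Fin.ext h2.symm)

lemma bandCone_isMogami : IsMogami (bandCone m) :=
  ⟨stripCone m, _, stripCone_isStrip.isTreeOfSimplicesC (by omega) (by omega),
    .single mogamiStep_closeStrip, represents_closeStrip⟩

end ConeOverBand

/-- for every `d ≥ 3` there is a `d`-pseudomanifold that is
Mogami but not LC. -/
theorem stmt14 (d : ℕ) (hd : 3 ≤ d) :
    ∃ (M N : ℕ) (f : Config (Fin M) d N),
      IsPseudo f ∧ IsMogami f ∧ ¬ IsLC f := by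
  obtain ⟨m, rfl⟩ := Nat.exists_eq_add_of_le' hd
  let e : Fin 5 ⊕ Fin (m + 3 + 1) ≃ Fin (5 + (m + 3 + 1)) := finSumFinEquiv
  refine ⟨_, 5, fun i j => e (bandCone m i j), bandCone_isPseudo.relabel e,
    bandCone_isMogami.relabel e e.injective, fun h => bandCone_not_isLC (m := m) ?_⟩
  simpa using h.relabel e.symm e.symm.injective

end MogamiPaper
end

section
/- Every triangulated 2-sphere and every triangulated 2-disk is extensively LC: for every spanning tree T of its dual graph, it can be obtained from the tree of triangles dual to T via LC gluings (identifications of pairs of boundary edges sharing a vertex). -/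
open Finset

namespace MogamiPaper

/-- Every mod 2 cocycle is a coboundary: local `ZMod 2`-potentials on the sets `A i` that differ by
a constant on each overlap can be corrected by constants to agree on all overlaps. -/
def TrivialCocycles {ι V : Type*} (A : ι → Finset V) : Prop :=
  ∀ h : ι → V → ZMod 2,
    (∀ i k, ∀ v ∈ A i, v ∈ A k → ∀ v' ∈ A i, v' ∈ A k → h i v + h k v = h i v' + h k v') →
    ∃ n : ι → ZMod 2, ∀ i k, ∀ v ∈ A i, v ∈ A k → h i v + h k v = n i + n k

lemma _root_.SimpleGraph.Connected.eq_of_forall_adj {ι α : Type*} {T : SimpleGraph ι}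
    (hT : T.Connected)
    {n : ι → α} (hn : ∀ i k, T.Adj i k → n i = n k) (i k : ι) : n i = n k := by
  obtain ⟨p⟩ := hT.preconnected i k
  induction p with
  | nil => rfl
  | cons hab _ ih => exact (hn _ _ hab).trans ih


/-- A function on the members of a strongly connected family that does not change across the
pairs at `w` is constant on the star of `w`: vertex links are connected. -/
lemma TrivialCocycles.star_const {ι V : Type*} {A : ι → Finset V}
    (hA : TrivialCocycles A) {T : SimpleGraph ι}
    (hT : T.Connected)
    (hTA : ∀ i k, T.Adj i k → ∃ u w, u ≠ w ∧ u ∈ A i ∧ u ∈ A k ∧ w ∈ A i ∧ w ∈ A k)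
    (w : V) (h : ι → ZMod 2)
    (hh : ∀ i k u, u ≠ w → u ∈ A i → u ∈ A k → w ∈ A i → w ∈ A k → h i = h k)
    {i k : ι} (hi : w ∈ A i) (hk : w ∈ A k) : h i = h k := by
  classical
  obtain ⟨n, hn⟩ := hA (fun i v => if v = w then h i else 0) (by
    intro i k v hvi hvk v' hvi' hvk'
    have := hh i k
    by_cases h1 : v = w <;> by_cases h2 : v' = w
    · simp [h1, h2]
    · subst h1; simp [h2, hh i k v' h2 hvi' hvk' hvi hvk, CharTwo.add_self_eq_zero]
    · subst h2; simp [h1, hh i k v h1 hvi hvk hvi' hvk', CharTwo.add_self_eq_zero]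
    · simp [h1, h2])
  have hadj : ∀ i k, T.Adj i k → n i = n k := by
    intro i k hik
    obtain ⟨u, x, hux, hui, huk, hxi, hxk⟩ := hTA i k hik
    rcases eq_or_ne u w with rfl | hu
    · have := hn i k x hxi hxk
      rw [if_neg hux.symm, if_neg hux.symm, add_zero] at this
      exact CharTwo.add_eq_zero.mp this.symm
    · have := hn i k u hui huk
      rw [if_neg hu, if_neg hu, add_zero] at this
      exact CharTwo.add_eq_zero.mp this.symm
  have hconst : n i = n k := hT.eq_of_forall_adj hadj i k
  have := hn i k w hi hk
  rw [if_pos rfl, if_pos rfl, hconst, CharTwo.add_self_eq_zero] at this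
  exact CharTwo.add_eq_zero.mp this


lemma sum_sum_sym2_eq_zero {V : Type*} [Fintype V] (c : Sym2 V → ZMod 2)
    (hc : ∀ v, c s(v, v) = 0) : ∑ w, ∑ u, c s(w, u) = 0 := by
  rw [← Fintype.sum_prod_type' fun w u => c s(w, u)]
  refine Finset.sum_involution (fun p _ => p.swap) ?_ ?_ (by simp) (by simp)
  · rintro ⟨w, u⟩ -
    simp only [Prod.swap_prod_mk, Sym2.eq_swap (a := u), CharTwo.add_self_eq_zero]
  · rintro ⟨w, u⟩ - h h'
    obtain rfl : u = w := congrArg Prod.fst h'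
    exact h (hc u)

/-- A nonempty finite graph with no vertex of degree one in `W` carries a nonzero mod 2 chain whose
boundary avoids `W`. -/
lemma _root_.SimpleGraph.exists_chain_of_degree_ne_one {V : Type*} [Fintype V] [DecidableEq V]
    (G : SimpleGraph V) [DecidableRel G.Adj] {a b : V} (hab : G.Adj a b) (W : Finset V)
    (hW : ∀ w ∈ W, G.degree w ≠ 1) :
    ∃ c : Sym2 V → ZMod 2, (∀ e ∉ G.edgeSet, c e = 0) ∧ (∃ e, c e ≠ 0) ∧
      ∀ w ∈ W, ∑ u, c s(w, u) = 0 := by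
  let W' := W.filter fun w => 0 < G.degree w
  let ext : (G.edgeSet → ZMod 2) →ₗ[ZMod 2] (Sym2 V → ZMod 2) :=
    { toFun := fun x e => if h : e ∈ G.edgeSet then x ⟨e, h⟩ else 0
      map_add' := by intro x y; ext e; by_cases h : e ∈ G.edgeSet <;> simp [h]
      map_smul' := by intro x y; ext e; by_cases h : e ∈ G.edgeSet <;> simp [h] }
  have ext_notMem : ∀ x, ∀ e ∉ G.edgeSet, ext x e = 0 := fun x e h => dif_neg h
  let B : (G.edgeSet → ZMod 2) →ₗ[ZMod 2] (W' → ZMod 2) :=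
    LinearMap.pi fun w => ∑ u, LinearMap.proj s(w.1, u) ∘ₗ ext
  have B_apply : ∀ x w, B x w = ∑ u, ext x s(w.1, u) := by
    intro x w
    simp [B]
  have degree_zero_sum : ∀ x w, G.degree w = 0 → ∑ u, ext x s(w, u) = 0 := by
    intro x w hw
    refine Finset.sum_eq_zero fun u _ => ext_notMem x _ fun h => ?_
    rw [SimpleGraph.mem_edgeSet] at h
    exact (G.degree_pos_iff_exists_adj w |>.2 ⟨u, h⟩).ne' hw
  by_cases hB : Function.Injective B
  · exfalso
    have h1 : #G.edgeFinset ≤ #W' := by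
      have := LinearMap.finrank_le_finrank_of_injective hB
      rwa [Module.finrank_fintype_fun_eq_card, Module.finrank_fintype_fun_eq_card,
        ← G.edgeFinset_card, Fintype.card_coe] at this
    have h2 : 2 * #W' ≤ ∑ w ∈ W', G.degree w := by
      rw [mul_comm, ← smul_eq_mul]
      refine Finset.card_nsmul_le_sum _ _ _ fun w hw => ?_
      have := Finset.mem_filter.1 hw
      have := hW w this.1
      omega
    have h3 := G.sum_degrees_eq_twice_card_edges
    have h4 := Finset.sum_add_sum_compl W' fun w => G.degree w
    have h5 : ∑ w ∈ W'ᶜ, G.degree w = 0 := by omega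
    have h6 : #G.edgeFinset = #W' := by omega
    rw [Finset.sum_eq_zero_iff] at h5
    have hsurj : Function.Surjective B :=
      (LinearMap.injective_iff_surjective_of_finrank_eq_finrank
        (by
          rwa [Module.finrank_fintype_fun_eq_card, Module.finrank_fintype_fun_eq_card,
            ← G.edgeFinset_card, Fintype.card_coe])).1 hB
    have ha : a ∈ W' := by
      by_contra h
      exact (G.degree_pos_iff_exists_adj a |>.2 ⟨b, hab⟩).ne' (h5 a (Finset.mem_compl.2 h))
    obtain ⟨x, hx⟩ := hsurj (Pi.single ⟨a, ha⟩ 1)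
    have key := sum_sum_sym2_eq_zero (ext x) fun v => ext_notMem x _ (by simp)
    rw [← Finset.sum_add_sum_compl W', Finset.sum_eq_zero (s := W'ᶜ) fun w hw =>
      degree_zero_sum x w (h5 w hw), add_zero, ← Finset.sum_coe_sort] at key
    simp_rw [← B_apply, hx] at key
    simp at key
  · rw [← LinearMap.ker_eq_bot, Submodule.eq_bot_iff] at hB
    push Not at hB
    obtain ⟨x, hx, hx0⟩ := hB
    refine ⟨ext x, ext_notMem x, ?_, ?_⟩
    · obtain ⟨e, he⟩ := Function.ne_iff.1 hx0
      exact ⟨e.1, by simpa [ext] using he⟩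
    · intro w hw
      by_cases hd : G.degree w = 0
      · exact degree_zero_sum x w hd
      · rw [← B_apply x ⟨w, Finset.mem_filter.2 ⟨hw, Nat.pos_of_ne_zero hd⟩⟩]
        exact congrFun (LinearMap.mem_ker.1 hx) _

/-- Solving `h i + h k = c u` around the vertex `w`, where `u` runs through the link of `w` and
`i`, `k` are the two triangles containing `w` and `u`. -/
lemma exists_star_potential {ι V : Type*} [Fintype ι] [DecidableEq ι] [Fintype V] [DecidableEq V]
    {A : ι → Finset V} (hA3 : ∀ i, #(A i) = 3)
    (hA2 : ∀ w u, w ≠ u → #{i | w ∈ A i ∧ u ∈ A i} ≤ 2) (w : V)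
    (hstar : ∀ h : ι → ZMod 2,
      (∀ i k u, u ≠ w → u ∈ A i → u ∈ A k → w ∈ A i → w ∈ A k → h i = h k) →
      ∀ i k, w ∈ A i → w ∈ A k → h i = h k)
    (c : V → ZMod 2) (hc : ∀ u, c u ≠ 0 → u ≠ w ∧ #{i | w ∈ A i ∧ u ∈ A i} = 2)
    (hsum : (∀ u i, u ≠ w → u ∈ A i → w ∈ A i → #{i | w ∈ A i ∧ u ∈ A i} = 2) → ∑ u, c u = 0) :
    ∃ h : ι → ZMod 2, ∀ i k u, i ≠ k → u ≠ w → u ∈ A i → u ∈ A k → w ∈ A i → w ∈ A k →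
      h i + h k = c u := by
  let Int : V → Prop := fun u => u ≠ w ∧ #{i | w ∈ A i ∧ u ∈ A i} = 2
  let δ : (ι → ZMod 2) →ₗ[ZMod 2] (V → ZMod 2) :=
    { toFun := fun h u => if Int u then ∑ i with w ∈ A i ∧ u ∈ A i, h i else 0
      map_add' := by
        intro x y; ext u; by_cases h : Int u <;> simp [h, Finset.sum_add_distrib]
      map_smul' := by intro x y; ext u; by_cases h : Int u <;> simp [h, Finset.mul_sum] }
  have δ_apply : ∀ h u, δ h u = if Int u then ∑ i with w ∈ A i ∧ u ∈ A i, h i else 0 :=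
    fun _ _ => rfl
  by_cases hrange : c ∈ LinearMap.range δ
  · obtain ⟨h, hh⟩ := hrange
    refine ⟨h, fun i k u hik hu hui huk hwi hwk => ?_⟩
    have hsub : {i, k} ⊆ ({i | w ∈ A i ∧ u ∈ A i} : Finset ι) := by
      intro j hj
      rcases Finset.mem_insert.1 hj with rfl | hj
      · simp [hui, hwi]
      · rw [Finset.mem_singleton.1 hj]; simp [huk, hwk]
    have hpair := Finset.eq_of_subset_of_card_le hsub
      (by rw [Finset.card_pair hik]; exact hA2 w u hu.symm)
    have hInt : Int u := ⟨hu, by rw [← hpair, Finset.card_pair hik]⟩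
    rw [← hh, δ_apply, if_pos hInt, ← hpair, Finset.sum_pair hik]
  · exfalso
    obtain ⟨l, hl, hker⟩ := Submodule.exists_le_ker_of_notMem hrange
    have l_apply : ∀ x, l x = ∑ u, x u * l (Pi.single u 1) := fun x => by
      rw [LinearMap.pi_apply_eq_sum_univ l x]
      refine Finset.sum_congr rfl fun u _ => ?_
      rw [smul_eq_mul]
      congr 2
      ext v
      simp [Pi.single_apply, eq_comm]
    let μ : V → ZMod 2 := fun u => if Int u then l (Pi.single u 1) else 0
    have hμ : ∀ i, w ∈ A i → ∃ x, ∀ u ∈ A i, u ≠ w → μ u = x := by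
      intro i hi
      have hzero : ∑ u ∈ (A i).erase w, μ u = 0 := by
        have : l (δ (Pi.single i 1)) = 0 := hker ⟨_, rfl⟩
        rw [l_apply] at this
        rw [← this, ← Finset.sum_subset (Finset.subset_univ ((A i).erase w))]
        · refine Finset.sum_congr rfl fun u hu => ?_
          by_cases hI : Int u
          · simp [δ_apply, hI, μ, hi, Finset.mem_of_mem_erase hu]
          · simp [δ_apply, hI, μ]
        · intro u _ hu
          by_cases hI : Int u
          · have : u ∉ A i := fun h => hu (Finset.mem_erase.2 ⟨hI.1, h⟩)
            simp [δ_apply, hI, this]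
          · simp [δ_apply, hI]
      have hcard : #((A i).erase w) = 2 := by rw [Finset.card_erase_of_mem hi, hA3]
      obtain ⟨a, b, hab, heq⟩ := Finset.card_eq_two.1 hcard
      rw [heq, Finset.sum_pair hab] at hzero
      refine ⟨μ a, fun u hu huw => ?_⟩
      have : u ∈ ({a, b} : Finset V) := heq ▸ Finset.mem_erase.2 ⟨huw, hu⟩
      rcases Finset.mem_insert.1 this with rfl | h
      · rfl
      · rw [Finset.mem_singleton.1 h]; exact (CharTwo.add_eq_zero.1 hzero).symm
    choose! x hx using hμ
    have hconst := hstar x fun i k u hu hui huk hwi hwk => by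
      rw [← hx i hwi u hui hu, ← hx k hwk u huk hu]
    apply hl
    have hlc : l c = ∑ u, c u * μ u := by
      rw [l_apply]
      refine Finset.sum_congr rfl fun u _ => ?_
      by_cases hcu : c u = 0
      · simp [hcu]
      · have hI : Int u := hc u hcu
        simp [μ, hI]
    rw [hlc]
    have hnbr : ∀ u, c u ≠ 0 → ∃ i, w ∈ A i ∧ u ∈ A i := by
      intro u hu
      have : (0 : ℕ) < #{i | w ∈ A i ∧ u ∈ A i} := by rw [(hc u hu).2]; norm_num
      obtain ⟨i, hi⟩ := Finset.card_pos.1 this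
      exact ⟨i, by simpa using hi⟩
    by_cases hall : ∀ u i, u ≠ w → u ∈ A i → w ∈ A i → #{i | w ∈ A i ∧ u ∈ A i} = 2
    · by_cases hne : ∃ i, w ∈ A i
      · obtain ⟨i, hi⟩ := hne
        have : ∀ u, c u * μ u = c u * x i := by
          intro u
          by_cases hcu : c u = 0
          · simp [hcu]
          · obtain ⟨k, hwk, huk⟩ := hnbr u hcu
            rw [hx k hwk u huk (hc u hcu).1, hconst k i hwk hi]
        simp_rw [this]
        rw [← Finset.sum_mul, hsum hall, zero_mul]
      · refine Finset.sum_eq_zero fun u _ => ?_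
        by_contra h
        obtain ⟨i, hi, -⟩ := hnbr u (left_ne_zero_of_mul h)
        exact hne ⟨i, hi⟩
    · push Not at hall
      obtain ⟨v, i, hvw, hvi, hwi, hv⟩ := hall
      have hxi : x i = 0 := by
        rw [← hx i hwi v hvi hvw]
        exact if_neg fun h => hv h.2
      refine Finset.sum_eq_zero fun u _ => ?_
      by_cases hcu : c u = 0
      · simp [hcu]
      · obtain ⟨k, hwk, huk⟩ := hnbr u hcu
        rw [hx k hwk u huk (hc u hcu).1, hconst k i hwk hwi, hxi, mul_zero]

/-- Let `l i` be lifts of the triangles `A i` that agree somewhere across each edge of a spanning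
tree of the dual graph. If two triangles whose lifts share a vertex always share the lifts of all
their common vertices, then all lifts agree. -/
theorem TrivialCocycles.lift_eq {ι V P : Type*} [Fintype ι] [Fintype V] {A : ι → Finset V}
    (hA : TrivialCocycles A) (hA3 : ∀ i, #(A i) = 3)
    (hA2 : ∀ w u, w ≠ u → ∀ s : Finset ι, (∀ i ∈ s, w ∈ A i ∧ u ∈ A i) → #s ≤ 2)
    {T : SimpleGraph ι} (hT : T.Connected)
    (hTA : ∀ i k, T.Adj i k → ∃ u w, u ≠ w ∧ u ∈ A i ∧ u ∈ A k ∧ w ∈ A i ∧ w ∈ A k)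
    (l : ι → V → P)
    (hl : ∀ i k u w, u ∈ A i → u ∈ A k → w ∈ A i → w ∈ A k → l i w = l k w → l i u = l k u)
    (hTl : ∀ i k, T.Adj i k → ∃ w, w ∈ A i ∧ w ∈ A k ∧ l i w = l k w)
    {i k : ι} {w : V} (hi : w ∈ A i) (hk : w ∈ A k) : l i w = l k w := by
  classical
  have hA2' : ∀ w u, w ≠ u → #{i | w ∈ A i ∧ u ∈ A i} ≤ 2 :=
    fun w u h => hA2 w u h _ fun i hi => by simpa using hi
  have hcell : ∀ {w u i k}, w ≠ u → i ≠ k → w ∈ A i → u ∈ A i → w ∈ A k → u ∈ A k →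
      ({i | w ∈ A i ∧ u ∈ A i} : Finset ι) = {i, k} := by
    intro w u i k hwu hik hwi hui hwk huk
    refine (Finset.eq_of_subset_of_card_le (fun j hj => ?_)
      (by rw [Finset.card_pair hik]; exact hA2' w u hwu)).symm
    rcases Finset.mem_insert.1 hj with rfl | hj
    · simp [hui, hwi]
    · rw [Finset.mem_singleton.1 hj]; simp [huk, hwk]
  let G : SimpleGraph V :=
    { Adj := fun w u => w ≠ u ∧ ∃ i k, w ∈ A i ∧ u ∈ A i ∧ w ∈ A k ∧ u ∈ A k ∧ l i w ≠ l k w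
      symm := ⟨fun w u ⟨hwu, i, k, hwi, hui, hwk, huk, h⟩ =>
        ⟨hwu.symm, i, k, hui, hwi, huk, hwk, fun h' => h (hl i k w u hwi hwk hui huk h')⟩⟩
      loopless := ⟨fun w h => h.1 rfl⟩ }
  by_cases hG : ∃ a b, G.Adj a b
  swap
  · push Not at hG
    have := hA.star_const hT hTA w (fun j => if l j w = l i w then 1 else 0) (by
      intro j j' u hu huj huj' hwj hwj'
      have : l j w = l j' w := by
        by_contra h
        exact hG w u ⟨hu.symm, j, j', hwj, huj, hwj', huj', h⟩
      rw [this]) hi hk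
    by_contra h
    simp [Ne.symm h] at this
  exfalso
  obtain ⟨a, b, hab⟩ := hG
  let W : Finset V :=
    {w | ∀ u i, u ≠ w → u ∈ A i → w ∈ A i → #{i | w ∈ A i ∧ u ∈ A i} = 2}
  have hdeg : ∀ w ∈ W, G.degree w ≠ 1 := by
    intro w hw hd
    simp only [W, Finset.mem_filter_univ] at hw
    obtain ⟨u₀, hu₀⟩ := Finset.card_eq_one.1 hd
    have hadj : ∀ u, G.Adj w u ↔ u = u₀ := fun u => by
      rw [← G.mem_neighborFinset, hu₀, Finset.mem_singleton]
    obtain ⟨hwu, i, k, hwi, hui, hwk, huk, hne⟩ := (hadj u₀).2 rfl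
    let χ : ι → ZMod 2 := fun j => if l j w = l i w then 1 else 0
    have h1 : ∑ u ∈ univ.erase w, ∑ j with w ∈ A j ∧ u ∈ A j, χ j = 0 := by
      simp_rw [Finset.sum_filter]
      rw [Finset.sum_comm]
      refine Finset.sum_eq_zero fun j _ => ?_
      rw [← Finset.sum_filter, Finset.sum_const]
      by_cases hwj : w ∈ A j
      · have : ({u ∈ univ.erase w | w ∈ A j ∧ u ∈ A j} : Finset V) = (A j).erase w := by
          ext u; simp [hwj]
        rw [this, Finset.card_erase_of_mem hwj, hA3, two_nsmul, CharTwo.add_self_eq_zero]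
      · simp [hwj]
    have h2 : ∀ u ∈ univ.erase w, u ≠ u₀ → ∑ j with w ∈ A j ∧ u ∈ A j, χ j = 0 := by
      intro u hu hu0
      by_cases hne : ∃ j, w ∈ A j ∧ u ∈ A j
      · obtain ⟨j, hwj, huj⟩ := hne
        obtain ⟨p, q, hpq, heq⟩ := Finset.card_eq_two.1 (hw u j (Finset.ne_of_mem_erase hu) huj hwj)
        have hp : w ∈ A p ∧ u ∈ A p := by
          have : p ∈ ({p, q} : Finset ι) := by simp
          rw [← heq] at this; simpa using this
        have hq : w ∈ A q ∧ u ∈ A q := by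
          have : q ∈ ({p, q} : Finset ι) := by simp
          rw [← heq] at this; simpa using this
        have : l p w = l q w := by
          by_contra h
          exact hu0 ((hadj u).1
            ⟨(Finset.ne_of_mem_erase hu).symm, p, q, hp.1, hp.2, hq.1, hq.2, h⟩)
        rw [heq, Finset.sum_pair hpq]
        simp only [χ, this]
        exact CharTwo.add_self_eq_zero _
      · push Not at hne
        refine Finset.sum_eq_zero fun j hj => ?_
        simp only [Finset.mem_filter_univ] at hj
        exact absurd hj.2 (hne j hj.1)
    have hik : i ≠ k := fun h => hne (by rw [h])
    rw [Finset.sum_eq_single_of_mem u₀ (by simp [hwu.symm]) h2, hcell hwu hik hwi hui hwk huk,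
      Finset.sum_pair hik] at h1
    simp [χ, Ne.symm hne] at h1
  obtain ⟨c, hc, ⟨e, he⟩, hcW⟩ := G.exists_chain_of_degree_ne_one hab W hdeg
  have hex : ∀ v, ∃ h : ι → ZMod 2, ∀ i k u, i ≠ k → u ≠ v → u ∈ A i → u ∈ A k → v ∈ A i →
      v ∈ A k → h i + h k = c s(v, u) := by
    intro v
    refine exists_star_potential hA3 hA2' v (fun h hh i k => hA.star_const hT hTA v h hh) _ ?_ ?_
    · intro u hu
      have : G.Adj v u := by
        by_contra h
        exact hu (hc _ h)
      obtain ⟨hvu, i, k, hvi, hui, hvk, huk, hne⟩ := this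
      have hik : i ≠ k := fun h => hne (by rw [h])
      rw [hcell hvu hik hvi hui hvk huk]
      exact ⟨hvu.symm, Finset.card_pair hik⟩
    · intro h
      exact hcW v (by simpa [W] using h)
  choose h hh using hex
  obtain ⟨n, hn⟩ := hA (fun i v => h v i) (by
    intro i k v hvi hvk v' hvi' hvk'
    rcases eq_or_ne v v' with rfl | hv
    · rfl
    rcases eq_or_ne i k with rfl | hik
    · simp only [CharTwo.add_self_eq_zero]
    rw [hh v i k v' hik hv.symm hvi' hvk' hvi hvk, hh v' i k v hik hv hvi hvk hvi' hvk',
      Sym2.eq_swap])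
  have hconst := hT.eq_of_forall_adj (n := n) (by
    intro i k hik
    obtain ⟨u, x, hux, hui, huk, hxi, hxk⟩ := hTA i k hik
    obtain ⟨w, hwi, hwk, hw⟩ := hTl i k hik
    have hx := hl i k x w hxi hxk hwi hwk hw
    have : c s(x, u) = 0 := by
      by_contra hcu
      have hG : G.Adj x u := by
        by_contra h
        exact hcu (hc _ h)
      obtain ⟨hxu, p, q, hxp, hup, hxq, huq, hne⟩ := hG
      have hpq : p ≠ q := fun h => hne (by rw [h])
      have := (hcell hxu hpq hxp hup hxq huq).symm.trans (hcell hxu hik.ne hxi hui hxk huk)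
      have hp : p ∈ ({i, k} : Finset ι) := by rw [← this]; simp
      have hq : q ∈ ({i, k} : Finset ι) := by rw [← this]; simp
      simp only [Finset.mem_insert, Finset.mem_singleton] at hp hq
      rcases hp with rfl | rfl <;> rcases hq with rfl | rfl <;> simp_all
    have h1 := hn i k x hxi hxk
    rw [hh x i k u hik.ne hux hui huk hxi hxk, this] at h1
    exact CharTwo.add_eq_zero.1 h1.symm)
  induction e with | _ u v =>
  have hG : G.Adj u v := by
    by_contra h
    exact he (hc _ h)
  obtain ⟨huv, p, q, hup, hvp, huq, hvq, hne⟩ := hG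
  have hpq : p ≠ q := fun h => hne (by rw [h])
  apply he
  rw [← hh u p q v hpq huv.symm hvp hvq hup huq, hn p q u hup huq, hconst p q,
    CharTwo.add_self_eq_zero]

/-- Every continuous family of lines in `ℝ^V`, given by nonzero vectors `y x` up to sign, is spanned
by a continuous family of vectors `± y x`. -/
def HasSignLifts (V : Type*) [Fintype V] (X : Type*) [TopologicalSpace X] : Prop :=
  ∀ y : X → V → ℝ, (∀ x, y x ≠ 0) → (∀ v v', Continuous fun x => y x v * y x v') →
    ∃ z : X → V → ℝ, Continuous z ∧ ∀ x, z x = y x ∨ z x = -y x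

section SignLifts

variable {V : Type*} [Fintype V]

lemma HasSignLifts.of_homeomorph {X Y : Type*} [TopologicalSpace X] [TopologicalSpace Y]
    (hY : HasSignLifts V Y) (e : X ≃ₜ Y) : HasSignLifts V X := by
  intro y hy hc
  obtain ⟨z, hz, h⟩ := hY (y ∘ e.symm) (fun x => hy _) fun v v' => (hc v v').comp e.symm.continuous
  exact ⟨z ∘ e, hz.comp e.continuous, fun x => by simpa using h (e x)⟩

lemma exists_sign_lift_of_dotProduct_ne_zero {X : Type*} [TopologicalSpace X] {y z : X → V → ℝ}
    (hy : ∀ v v', Continuous fun x => y x v * y x v') (hz : Continuous z)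
    (hyz : ∀ x, y x ⬝ᵥ z x ≠ 0) :
    ∃ z' : X → V → ℝ, Continuous z' ∧ ∀ x, z' x = y x ∨ z' x = -y x := by
  have hzv : ∀ v, Continuous fun x => z x v := fun v => (continuous_apply v).comp hz
  have h1 : ∀ v, Continuous fun x => y x v * (y x ⬝ᵥ z x) := by
    intro v
    have : (fun x => y x v * (y x ⬝ᵥ z x)) = fun x => ∑ v', y x v * y x v' * z x v' := by
      ext x; simp [dotProduct, Finset.mul_sum, mul_assoc]
    rw [this]
    exact continuous_finsetSum _ fun v' _ => (hy v v').mul (hzv v')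
  have h2 : Continuous fun x => |y x ⬝ᵥ z x| := by
    have : (fun x => |y x ⬝ᵥ z x|) = fun x => √(∑ v, y x v * (y x ⬝ᵥ z x) * z x v) := by
      ext x
      rw [← Real.sqrt_sq_eq_abs]
      congr 1
      rw [sq]
      nth_rw 1 [dotProduct]
      rw [Finset.sum_mul]
      exact Finset.sum_congr rfl fun v _ => by ring
    rw [this]
    exact (continuous_finsetSum _ fun v _ => (h1 v).mul (hzv v)).sqrt
  refine ⟨fun x v => y x v * (y x ⬝ᵥ z x) / |y x ⬝ᵥ z x|,
    continuous_pi fun v => (h1 v).div h2 fun x => abs_ne_zero.2 (hyz x), fun x => ?_⟩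
  rcases lt_or_gt_of_ne (hyz x) with h | h
  · right
    ext v
    simp only [abs_of_neg h, Pi.neg_apply]
    rw [div_neg, mul_div_cancel_right₀ _ (hyz x)]
  · left
    ext v
    simp only [abs_of_pos h]
    rw [mul_div_cancel_right₀ _ (hyz x)]

lemma hasSignLifts_closedBall {E : Type*} [NormedAddCommGroup E] [NormedSpace ℝ E]
    [ProperSpace E] : HasSignLifts V (Metric.closedBall (0 : E) 1) := by
  intro y hy hc
  let K : Metric.closedBall (0 : E) 1 × Metric.closedBall (0 : E) 1 → ℝ :=
    fun p => (y p.1 ⬝ᵥ y p.2) ^ 2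
  have hK : Continuous K := by
    have : K = fun p => ∑ v, ∑ v', (y p.1 v * y p.1 v') * (y p.2 v * y p.2 v') := by
      ext p
      simp only [K, sq, dotProduct, Finset.sum_mul_sum]
      exact Finset.sum_congr rfl fun v _ => Finset.sum_congr rfl fun v' _ => by ring
    rw [this]
    exact continuous_finsetSum _ fun v _ => continuous_finsetSum _ fun v' _ =>
      ((hc v v').comp continuous_fst).mul ((hc v v').comp continuous_snd)
  have hU : {p | K p ≠ 0} ∈ uniformity (Metric.closedBall (0 : E) 1) := by
    have : CompactSpace (Metric.closedBall (0 : E) 1) :=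
      isCompact_iff_compactSpace.1 (isCompact_closedBall 0 1)
    rw [← nhdsSet_diagonal_eq_uniformity, (isOpen_ne_fun hK continuous_const).mem_nhdsSet]
    rintro ⟨x, x'⟩ (h : x = x')
    subst h
    exact pow_ne_zero 2 fun h => hy x (dotProduct_self_eq_zero.1 h)
  obtain ⟨δ, hδ, hKδ⟩ := Metric.mem_uniformity_dist.1 hU
  obtain ⟨n, hn⟩ := exists_nat_one_div_lt hδ
  have hn0 : (0 : ℝ) < n + 1 := by positivity
  have hmem : ∀ k : ℕ, k ≤ n + 1 → ∀ x : Metric.closedBall (0 : E) 1,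
      ((k / (n + 1) : ℝ) • (x : E)) ∈ Metric.closedBall (0 : E) 1 := by
    intro k hk x
    have hx := mem_closedBall_zero_iff.1 x.2
    rw [mem_closedBall_zero_iff, norm_smul, Real.norm_of_nonneg (by positivity)]
    have : (k / (n + 1) : ℝ) ≤ 1 := by
      rw [div_le_one hn0]; exact_mod_cast hk
    nlinarith [norm_nonneg (x : E)]
  have key : ∀ k : ℕ, ∀ hk : k ≤ n + 1, ∃ z : Metric.closedBall (0 : E) 1 → V → ℝ,
      Continuous z ∧ ∀ x, z x = y ⟨_, hmem k hk x⟩ ∨ z x = -y ⟨_, hmem k hk x⟩ := by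
    intro k
    induction k with
    | zero =>
      intro hk
      refine ⟨fun _ => y ⟨0, by simp⟩, continuous_const, fun x => Or.inl ?_⟩
      simp
    | succ k ih =>
      intro hk
      obtain ⟨z, hz, hzy⟩ := ih (by omega)
      have hs : Continuous fun x => (⟨_, hmem (k + 1) hk x⟩ : Metric.closedBall (0 : E) 1) :=
        (continuous_subtype_val.const_smul _).subtype_mk _
      refine exists_sign_lift_of_dotProduct_ne_zero (fun v v' => (hc v v').comp hs) hz fun x => ?_
      have hd : dist (⟨_, hmem (k + 1) hk x⟩ : Metric.closedBall (0 : E) 1)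
          ⟨_, hmem k (by omega) x⟩ < δ := by
        refine lt_of_le_of_lt ?_ hn
        rw [Subtype.dist_eq, dist_eq_norm, ← sub_smul, norm_smul]
        have : (((k + 1 : ℕ) : ℝ) / (n + 1) - k / (n + 1)) = 1 / (n + 1) := by
          push_cast; ring
        rw [this, Real.norm_of_nonneg (by positivity)]
        exact mul_le_of_le_one_right (by positivity) (mem_closedBall_zero_iff.1 x.2)
      have := hKδ hd
      have hne : y ⟨_, hmem (k + 1) hk x⟩ ⬝ᵥ y ⟨_, hmem k (by omega) x⟩ ≠ 0 := fun h =>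
        this (by simp only [K, h]; norm_num)
      rcases hzy x with h | h
      · rw [h]; exact hne
      · rw [h, dotProduct_neg]; exact neg_ne_zero.2 hne
  obtain ⟨z, hz, hzy⟩ := key (n + 1) le_rfl
  refine ⟨z, hz, fun x => ?_⟩
  have : (⟨_, hmem (n + 1) le_rfl x⟩ : Metric.closedBall (0 : E) 1) = x := by
    ext
    push_cast
    rw [div_self hn0.ne', one_smul]
  simpa only [this] using hzy x

lemma forall_pos_or_forall_neg {X : Type*} [TopologicalSpace X] [PreconnectedSpace X] {g : X → ℝ}
    (hg : Continuous g) (h0 : ∀ x, g x ≠ 0) : (∀ x, 0 < g x) ∨ ∀ x, g x < 0 := by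
  by_contra! h
  obtain ⟨⟨a, ha⟩, b, hb⟩ := h
  obtain ⟨x, hx⟩ := mem_range_of_exists_le_of_exists_ge hg ⟨a, ha⟩ ⟨b, hb⟩
  exact h0 x hx

lemma hasSignLifts_sphere :
    HasSignLifts V (Metric.sphere (0 : EuclideanSpace ℝ (Fin 3)) 1) := by
  intro y hy hc
  have hmem : ∀ s : ℝ, s ^ 2 = 1 → ∀ x : Metric.closedBall (0 : EuclideanSpace ℝ (Fin 2)) 1,
      !₂[x.1 0, x.1 1, s * √(1 - ‖x.1‖ ^ 2)] ∈ Metric.sphere (0 : EuclideanSpace ℝ (Fin 3)) 1 := by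
    intro s hs x
    have hx := mem_closedBall_zero_iff.1 x.2
    rw [mem_sphere_zero_iff_norm, EuclideanSpace.norm_eq, Real.sqrt_eq_one]
    have h1 : (0 : ℝ) ≤ 1 - ‖x.1‖ ^ 2 := by nlinarith [norm_nonneg x.1]
    have h2 := EuclideanSpace.norm_sq_eq x.1
    simp only [Fin.sum_univ_two, Real.norm_eq_abs, sq_abs] at h2
    simp [Fin.sum_univ_three, mul_pow, hs, Real.sq_sqrt h1]
    linarith
  have hlift : ∀ s : ℝ, ∀ hs : s ^ 2 = 1, ∃ z : Metric.closedBall (0 : EuclideanSpace ℝ (Fin 2)) 1 → V → ℝ,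
      Continuous z ∧ ∀ x, z x = y ⟨_, hmem s hs x⟩ ∨ z x = -y ⟨_, hmem s hs x⟩ := by
    intro s hs
    refine hasSignLifts_closedBall (fun x => y ⟨_, hmem s hs x⟩) (fun x => hy _) fun v v' => ?_
    refine (hc v v').comp (f := fun x => ⟨_, hmem s hs x⟩) (Continuous.subtype_mk ?_ _)
    refine (PiLp.continuous_toLp 2 _).comp (continuous_pi fun j => ?_)
    fin_cases j <;> simp <;> fun_prop
  obtain ⟨zp, hzp, hp⟩ := hlift 1 (by norm_num)
  obtain ⟨zm, hzm, hm⟩ := hlift (-1) (by norm_num)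
  have heq : ∀ x : Metric.closedBall (0 : EuclideanSpace ℝ (Fin 2)) 1, ‖x.1‖ = 1 →
      (⟨_, hmem 1 (by norm_num) x⟩ : Metric.sphere (0 : EuclideanSpace ℝ (Fin 3)) 1) =
        ⟨_, hmem (-1) (by norm_num) x⟩ := by
    intro x hx
    simp [hx]
  have hpm : ∀ x : Metric.closedBall (0 : EuclideanSpace ℝ (Fin 2)) 1, ‖x.1‖ = 1 → zp x = zm x ∨ zp x = -zm x := by
    intro x hx
    have h1 := hp x
    rw [heq x hx] at h1
    rcases h1 with h1 | h1 <;> rcases hm x with h2 | h2 <;> simp [h1, h2]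
  have hzp0 : ∀ x, zp x ≠ 0 := by
    intro x
    rcases hp x with h | h <;> simp [h, hy]
  have hcirc : ∃ zm' : Metric.closedBall (0 : EuclideanSpace ℝ (Fin 2)) 1 → V → ℝ, Continuous zm' ∧
      (∀ x, zm' x = y ⟨_, hmem (-1) (by norm_num) x⟩ ∨
        zm' x = -y ⟨_, hmem (-1) (by norm_num) x⟩) ∧
      ∀ x : Metric.closedBall (0 : EuclideanSpace ℝ (Fin 2)) 1, ‖x.1‖ = 1 → zp x = zm' x := by
    have hconn : PreconnectedSpace (Metric.sphere (0 : EuclideanSpace ℝ (Fin 2)) 1) :=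
      isPreconnected_iff_preconnectedSpace.1 (isPreconnected_sphere (by
        rw [← Module.finrank_eq_rank]; simp) 0 1)
    let inc : Metric.sphere (0 : EuclideanSpace ℝ (Fin 2)) 1 → Metric.closedBall (0 : EuclideanSpace ℝ (Fin 2)) 1 :=
      Set.inclusion Metric.sphere_subset_closedBall
    have hinc : Continuous inc := continuous_inclusion _
    have hself : ∀ x, 0 < zp x ⬝ᵥ zp x := fun x =>
      lt_of_le_of_ne (Finset.sum_nonneg fun v _ => mul_self_nonneg _)
        fun h => hzp0 x (dotProduct_self_eq_zero.1 h.symm)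
    have hnorm : ∀ x, ‖(inc x).1‖ = 1 := fun x => mem_sphere_zero_iff_norm.1 x.2
    rcases forall_pos_or_forall_neg (g := fun x => zp (inc x) ⬝ᵥ zm (inc x))
      (by unfold dotProduct; fun_prop) (by
        intro x
        have := hself (inc x)
        rcases hpm (inc x) (hnorm x) with h | h
        · simp only [← h]; exact this.ne'
        · rw [eq_neg_iff_add_eq_zero, add_comm, ← eq_neg_iff_add_eq_zero] at h
          simp only [h, dotProduct_neg]
          exact (neg_neg_of_pos this).ne) with hs | hs
    · refine ⟨zm, hzm, hm, fun x hx => ?_⟩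
      rcases hpm x hx with h | h
      · exact h
      · have h1 : 0 < zp x ⬝ᵥ zm x := hs ⟨x.1, mem_sphere_zero_iff_norm.2 hx⟩
        have h2 := hself x
        nth_rw 2 [h] at h2
        rw [dotProduct_neg] at h2
        linarith
    · refine ⟨-zm, hzm.neg, fun x => ?_, fun x hx => ?_⟩
      · rcases hm x with h | h <;> simp [h]
      · rcases hpm x hx with h | h
        · have h1 : zp x ⬝ᵥ zm x < 0 := hs ⟨x.1, mem_sphere_zero_iff_norm.2 hx⟩
          have h2 := hself x
          nth_rw 2 [h] at h2
          linarith
        · exact h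
  obtain ⟨zm', hzm', hm', heq'⟩ := hcirc
  have hproj : ∀ p : Metric.sphere (0 : EuclideanSpace ℝ (Fin 3)) 1,
      ‖(!₂[p.1 0, p.1 1] : EuclideanSpace ℝ (Fin 2))‖ ^ 2 = 1 - p.1 2 ^ 2 := by
    intro p
    have h := EuclideanSpace.norm_sq_eq p.1
    rw [mem_sphere_zero_iff_norm.1 p.2] at h
    rw [EuclideanSpace.norm_sq_eq]
    simp [Fin.sum_univ_three, Fin.sum_univ_two] at h ⊢
    linarith
  let proj : Metric.sphere (0 : EuclideanSpace ℝ (Fin 3)) 1 → Metric.closedBall (0 : EuclideanSpace ℝ (Fin 2)) 1 :=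
    fun p => ⟨!₂[p.1 0, p.1 1], by
      rw [mem_closedBall_zero_iff]
      have := hproj p
      nlinarith [norm_nonneg (!₂[p.1 0, p.1 1] : EuclideanSpace ℝ (Fin 2)), sq_nonneg (p.1 2)]⟩
  have hprojc : Continuous proj := by
    refine Continuous.subtype_mk ((PiLp.continuous_toLp 2 _).comp (continuous_pi fun j => ?_)) _
    fin_cases j <;> simp <;> fun_prop
  refine ⟨fun p => if 0 ≤ p.1 2 then zp (proj p) else zm' (proj p),
    Continuous.if_le (hzp.comp hprojc) (hzm'.comp hprojc) continuous_const (by fun_prop) ?_, ?_⟩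
  · intro p h0
    refine heq' _ ?_
    have := hproj p
    rw [← h0] at this
    have h1 := norm_nonneg (!₂[p.1 0, p.1 1] : EuclideanSpace ℝ (Fin 2))
    change ‖(!₂[p.1 0, p.1 1] : EuclideanSpace ℝ (Fin 2))‖ = 1
    nlinarith
  · intro p
    have hback : ∀ s : ℝ, ∀ hs : s ^ 2 = 1, s * |p.1 2| = p.1 2 →
        (⟨_, hmem s hs (proj p)⟩ : Metric.sphere (0 : EuclideanSpace ℝ (Fin 3)) 1) = p := by
      intro s hs h
      ext j
      have := hproj p
      fin_cases j
      · simp [proj]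
      · simp [proj]
      · simp [proj, this, Real.sqrt_sq_eq_abs, h]
    by_cases h0 : 0 ≤ p.1 2
    · simp only [if_pos h0]
      simpa only [hback 1 (by norm_num) (by rw [abs_of_nonneg h0, one_mul])] using hp (proj p)
    · simp only [if_neg h0]
      simpa only [hback (-1) (by norm_num) (by rw [abs_of_neg (not_le.1 h0)]; ring)]
        using hm' (proj p)

end SignLifts

/-- The sign `(-1) ^ a`. -/
def zsign (a : ZMod 2) : ℝ := if a = 0 then 1 else -1

lemma zsign_mul (a b : ZMod 2) : zsign a * zsign b = zsign (a + b) := by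
  have hcases : ∀ a : ZMod 2, a = 0 ∨ a = 1 := by decide
  have h2 : (1 + 1 : ZMod 2) = 0 := rfl
  rcases hcases a with rfl | rfl <;> rcases hcases b with rfl | rfl <;> simp [zsign, h2]

lemma zsign_ne_zero (a : ZMod 2) : zsign a ≠ 0 := by
  unfold zsign
  split_ifs <;> norm_num

lemma trivialCocycles_of_hasSignLifts {V : Type*} [DecidableEq V] [Fintype V] {d N : ℕ}
    (f : Config V d N)
    (hX : HasSignLifts V (realization f)) : TrivialCocycles (facet f) := by
  intro h hh
  choose tri htri using fun x : realization f => x.2.2.2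
  have hx0 : ∀ x : realization f, ∃ v, x.1 v ≠ 0 := fun x => by
    by_contra! hx
    have := x.2.2.1
    simp [hx] at this
  have hcoord : ∀ v, Continuous fun x : realization f => x.1 v := fun v =>
    (continuous_apply v).comp continuous_subtype_val
  have hprod : ∀ x : realization f, ∀ i, (∀ v, x.1 v ≠ 0 → v ∈ facet f i) → ∀ v v',
      zsign (h (tri x) v) * x.1 v * (zsign (h (tri x) v') * x.1 v') =
        zsign (h i v) * x.1 v * (zsign (h i v') * x.1 v') := by
    intro x i hi v v'
    by_cases hv : x.1 v = 0
    · simp [hv]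
    by_cases hv' : x.1 v' = 0
    · simp [hv']
    have h1 := hh (tri x) i v (htri x v hv) (hi v hv) v' (htri x v' hv') (hi v' hv')
    have h2 : h (tri x) v + h (tri x) v' = h i v + h i v' := by
      rw [← CharTwo.add_eq_zero] at h1 ⊢
      rw [← h1]; ring
    rw [mul_mul_mul_comm, mul_mul_mul_comm (zsign (h i v)), zsign_mul, zsign_mul, h2]
  obtain ⟨z, hz, hzy⟩ := hX (fun x v => zsign (h (tri x) v) * x.1 v)
    (fun x hx => by
      obtain ⟨v, hv⟩ := hx0 x
      exact mul_ne_zero (zsign_ne_zero _) hv (congrFun hx v))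
    (fun v v' => by
      refine (locallyFinite_of_finite fun i : Fin N =>
        {x : realization f | ∀ v, v ∉ facet f i → x.1 v = 0}).continuous ?_ ?_ ?_
      · refine Set.eq_univ_of_forall fun x => Set.mem_iUnion.2 ⟨tri x, fun v hv => ?_⟩
        by_contra h
        exact hv (htri x v h)
      · intro i
        simp only [Set.ofPred_forall]
        exact isClosed_iInter fun v => isClosed_iInter fun _ =>
          isClosed_eq (hcoord v) continuous_const
      · intro i
        refine ContinuousOn.congr (f := fun x : realization f =>
          zsign (h i v) * x.1 v * (zsign (h i v') * x.1 v')) (Continuous.continuousOn ?_) ?_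
        · exact (continuous_const.mul (hcoord v)).mul (continuous_const.mul (hcoord v'))
        · intro x hx
          exact hprod x i (fun v hv => by_contra fun h => hv (hx v h)) v v')
  have hsign : ∀ i, ∃ n : ZMod 2, ∀ x : realization f, (∀ v, x.1 v ≠ 0 → v ∈ facet f i) →
      0 < zsign n * ∑ v, z x v * (zsign (h i v) * x.1 v) := by
    intro i
    let D : Set (V → ℝ) := {x | (∀ v, 0 ≤ x v) ∧ ∑ v, x v = 1 ∧ ∀ v, x v ≠ 0 → v ∈ facet f i}
    have hD : Convex ℝ D := by
      intro x hx y hy a b ha hb hab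
      refine ⟨fun v => ?_, ?_, fun v hv => ?_⟩
      · have := hx.1 v
        have := hy.1 v
        simp only [Pi.add_apply, Pi.smul_apply, smul_eq_mul]
        positivity
      · simp only [Pi.add_apply, Pi.smul_apply, smul_eq_mul, Finset.sum_add_distrib,
          ← Finset.mul_sum, hx.2.1, hy.2.1, mul_one, hab]
      · by_contra hvi
        apply hv
        have h1 : x v = 0 := by_contra fun h => hvi (hx.2.2 v h)
        have h2 : y v = 0 := by_contra fun h => hvi (hy.2.2 v h)
        simp [h1, h2]
    have : PreconnectedSpace D := isPreconnected_iff_preconnectedSpace.1 hD.isPreconnected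
    let inc : D → realization f := fun x => ⟨x.1, x.2.1, x.2.2.1, i, x.2.2.2⟩
    have hinc : Continuous inc := continuous_subtype_val.subtype_mk _
    have hcont : Continuous fun x : D => ∑ v, z (inc x) v * (zsign (h i v) * x.1 v) :=
      continuous_finsetSum _ fun v _ => ((continuous_apply v).comp (hz.comp hinc)).mul
        (continuous_const.mul ((hcoord v).comp hinc))
    rcases forall_pos_or_forall_neg hcont (by
      intro x hx
      obtain ⟨w, hw⟩ := hx0 (inc x)
      have h1 : ∑ v, zsign (h (tri (inc x)) v) * x.1 v * (zsign (h i v) * x.1 v) = 0 := by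
        rcases hzy (inc x) with hzx | hzx
        · simpa [hzx] using hx
        · simpa [hzx] using hx
      have h2 : ∀ v, zsign (h (tri (inc x)) w) * zsign (h i w) * (x.1 v * x.1 v) =
          zsign (h (tri (inc x)) v) * x.1 v * (zsign (h i v) * x.1 v) := by
        intro v
        by_cases hv : x.1 v = 0
        · simp [hv]
        rw [mul_mul_mul_comm (zsign _) (x.1 v), zsign_mul, zsign_mul,
          hh _ i w (htri (inc x) w hw) (x.2.2.2 w hw) v (htri (inc x) v hv) (x.2.2.2 v hv)]
      simp_rw [← h2] at h1
      rw [← Finset.mul_sum] at h1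
      have h3 : 0 < ∑ v, x.1 v * x.1 v :=
        Finset.sum_pos' (fun v _ => mul_self_nonneg _) ⟨w, Finset.mem_univ _, mul_self_pos.2 hw⟩
      exact mul_ne_zero (mul_ne_zero (zsign_ne_zero _) (zsign_ne_zero _)) h3.ne' h1)
      with hs | hs
    · refine ⟨0, fun x hx => ?_⟩
      simpa [zsign] using hs ⟨x.1, x.2.1, x.2.2.1, hx⟩
    · refine ⟨1, fun x hx => ?_⟩
      simpa [zsign] using hs ⟨x.1, x.2.1, x.2.2.1, hx⟩
  choose n hn using hsign
  refine ⟨n, fun i k v hvi hvk => ?_⟩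
  have hvert : ∀ j, v ∈ facet f j → ∀ u, (Pi.single v 1 : V → ℝ) u ≠ 0 → u ∈ facet f j := by
    intro j hj u hu
    rcases eq_or_ne u v with rfl | huv
    · exact hj
    · exact absurd (Pi.single_eq_of_ne huv _) hu
  let x : realization f := ⟨Pi.single v 1,
    fun u => (Pi.single_nonneg.2 zero_le_one : (0 : V → ℝ) ≤ Pi.single v 1) u, by simp,
    i, hvert i hvi⟩
  have hpos : ∀ j, v ∈ facet f j → 0 < z x v * zsign (n j + h j v) := by
    intro j hj
    have := hn j x (hvert j hj)
    rw [Finset.sum_eq_single_of_mem v (Finset.mem_univ _)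
      (fun u _ hu => by simp [x, Pi.single_eq_of_ne hu])] at this
    rw [← zsign_mul]
    simp only [x, Pi.single_eq_same, mul_one] at this ⊢
    linarith
  have hi := hpos i hvi
  have hk := hpos k hvk
  have hik : n i + h i v = n k + h k v := by
    have hcases : ∀ a : ZMod 2, a = 0 ∨ a = 1 := by decide
    rcases hcases (n i + h i v) with h1 | h1 <;> rcases hcases (n k + h k v) with h2 | h2 <;>
      rw [h1] at hi ⊢ <;> rw [h2] at hk ⊢ <;> simp [zsign] at hi hk <;> linarith
  rw [← CharTwo.add_eq_zero] at hik ⊢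
  rw [← hik]; ring

section Gluing

variable {V P : Type*} [DecidableEq P] {N : ℕ}

lemma mem_facet {d : ℕ} {f : Config P d N} {i : Fin N} {v : P} :
    v ∈ facet f i ↔ ∃ j, f i j = v := by
  simp [facet]

lemma injOn_facet {f : Config V 2 N} (hf : Proper f) {g : Config P 2 N} {e : P → V}
    (hg : ∀ i j, e (g i j) = f i j) {i : Fin N} {x y : P} (hx : x ∈ facet g i)
    (hy : y ∈ facet g i) (h : e x = e y) : x = y := by
  obtain ⟨j, rfl⟩ := mem_facet.1 hx
  obtain ⟨l, rfl⟩ := mem_facet.1 hy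
  rw [hg, hg] at h
  rw [hf i h]

variable [DecidableEq V]

lemma card_facet {f : Config V 2 N} (hf : Proper f) (i : Fin N) : #(facet f i) = 3 := by
  rw [facet, Finset.card_image_of_injective _ (hf i)]
  simp

lemma mem_cells_pair {d : ℕ} {f : Config V d N} {u w : V} {i : Fin N} :
    i ∈ cells f {u, w} ↔ u ∈ facet f i ∧ w ∈ facet f i := by
  simp [cells, Finset.insert_subset_iff]

lemma dualGraph_adj {f : Config V 2 N} {i k : Fin N} :
    (dualGraph f).Adj i k ↔
      i ≠ k ∧ ∃ u w, u ≠ w ∧ u ∈ facet f i ∧ u ∈ facet f k ∧ w ∈ facet f i ∧ w ∈ facet f k := by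
  have hR : ∀ i k, (∃ R : Finset V, #R = 2 ∧ R ⊆ facet f i ∧ R ⊆ facet f k) ↔
      ∃ u w, u ≠ w ∧ u ∈ facet f i ∧ u ∈ facet f k ∧ w ∈ facet f i ∧ w ∈ facet f k := by
    intro i k
    constructor
    · rintro ⟨R, hR, hi, hk⟩
      obtain ⟨u, w, huw, rfl⟩ := Finset.card_eq_two.1 hR
      exact ⟨u, w, huw, hi (by simp), hk (by simp), hi (by simp), hk (by simp)⟩
    · rintro ⟨u, w, huw, hui, huk, hwi, hwk⟩
      exact ⟨{u, w}, Finset.card_pair huw, by simp [Finset.insert_subset_iff, *],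
        by simp [Finset.insert_subset_iff, *]⟩
  rw [dualGraph, SimpleGraph.fromRel_adj, hR, hR]
  refine and_congr_right fun _ => ⟨?_, Or.inl⟩
  rintro (h | ⟨u, w, huw, h1, h2, h3, h4⟩)
  · exact h
  · exact ⟨u, w, huw, h2, h1, h4, h3⟩

lemma IsPseudo.card_le_two {f : Config V 2 N} (hf : IsPseudo f) {u w : V} (huw : u ≠ w)
    (s : Finset (Fin N)) (hs : ∀ i ∈ s, u ∈ facet f i ∧ w ∈ facet f i) : #s ≤ 2 :=
  (Finset.card_le_card fun i hi => mem_cells_pair.2 (hs i hi)).trans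
    (hf.2 {u, w} (Finset.card_pair huw))

lemma map_mem_facet {f : Config V 2 N} {g : Config P 2 N} {e : P → V}
    (hg : ∀ i j, e (g i j) = f i j) {i : Fin N} {x : P} (hx : x ∈ facet g i) :
    e x ∈ facet f i := by
  obtain ⟨j, rfl⟩ := mem_facet.1 hx
  exact mem_facet.2 ⟨j, (hg i j).symm⟩

/-- Folding two edges `{v, a}`, `{v, b}` with the same image in a pseudomanifold onto each other is
an LC gluing. -/
lemma lcStep_of_fold {f : Config V 2 N} (hf : IsPseudo f) {g : Config P 2 N} {e : P → V}
    (hg : ∀ i j, e (g i j) = f i j) {v a b : P} {i k : Fin N} (hab : a ≠ b) (hva : v ≠ a)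
    (he : e a = e b) (hvi : v ∈ facet g i) (hai : a ∈ facet g i) (hvk : v ∈ facet g k)
    (hbk : b ∈ facet g k) : LCStep g fun i j => if g i j = a then b else g i j := by
  have heva : e v ≠ e a := fun h => hva (injOn_facet hf.1 hg hvi hai h)
  have hvb : v ≠ b := fun h => heva (by rw [he, h])
  have hdisj : Disjoint (cells g {v, a}) (cells g {v, b}) := by
    rw [Finset.disjoint_left]
    intro l h1 h2
    exact hab (injOn_facet hf.1 hg (mem_cells_pair.1 h1).2 (mem_cells_pair.1 h2).2 he)
  have hle : #(cells g {v, a}) + #(cells g {v, b}) ≤ 2 := by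
    rw [← Finset.card_union_of_disjoint hdisj]
    refine hf.card_le_two heva _ fun l hl => ?_
    rcases Finset.mem_union.1 hl with hl | hl
    · exact ⟨map_mem_facet hg (mem_cells_pair.1 hl).1, map_mem_facet hg (mem_cells_pair.1 hl).2⟩
    · exact ⟨map_mem_facet hg (mem_cells_pair.1 hl).1,
        he ▸ map_mem_facet hg (mem_cells_pair.1 hl).2⟩
  have h1 : 0 < #(cells g {v, a}) := Finset.card_pos.2 ⟨i, mem_cells_pair.2 ⟨hvi, hai⟩⟩
  have h2 : 0 < #(cells g {v, b}) := Finset.card_pos.2 ⟨k, mem_cells_pair.2 ⟨hvk, hbk⟩⟩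
  refine ⟨{v, a}, {v, b}, ⟨Finset.card_pair hva, by omega⟩, ⟨Finset.card_pair hvb, by omega⟩,
    fun h => ?_, ?_, fun x => if x = a then b else x, fun x hx => ?_, ?_, ?_, fun _ _ => rfl⟩
  · have : a ∈ ({v, b} : Finset P) := by rw [← h]; simp
    simp [hab, hva.symm] at this
  · have : ({v, a} ∩ {v, b} : Finset P) = {v} := by
      ext x
      simp only [Finset.mem_inter, Finset.mem_insert, Finset.mem_singleton]
      grind
    simp [this]
  · simp only [Finset.mem_insert, Finset.mem_singleton, not_or] at hx
    simp [hx.2]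
  · intro x hx y hy h
    simp only [Finset.coe_insert, Finset.coe_singleton, Set.mem_insert_iff,
      Set.mem_singleton_iff] at hx hy
    grind
  · simp [Finset.image_insert, hva]

/-- A configuration over a pseudomanifold with trivial cocycles, whose triangles meet along a
spanning tree of the dual graph, can be glued up by LC gluings. -/
lemma exists_lcSteps [Fintype V] {f : Config V 2 N} (hf : IsPseudo f)
    (hA : TrivialCocycles (facet f)) {T : SimpleGraph (Fin N)} (hT : T.Connected)
    (hTf : T ≤ dualGraph f) (e : P → V) (g : Config P 2 N) (hg : ∀ i j, e (g i j) = f i j)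
    (hTg : ∀ i k, T.Adj i k → ∃ j l, g i j = g k l) :
    ∃ g' : Config P 2 N, Relation.ReflTransGen LCStep g g' ∧
      Set.InjOn e {x | ∃ i j, g' i j = x} ∧ ∀ i j, f i j = e (g' i j) := by
  induction hn : #(univ.image fun p : Fin N × Fin 3 => g p.1 p.2) using Nat.strong_induction_on
    generalizing g with
  | _ n ih =>
  by_cases hS : ∃ v a b i k, a ≠ b ∧ v ≠ a ∧ e a = e b ∧ v ∈ facet g i ∧ a ∈ facet g i ∧
      v ∈ facet g k ∧ b ∈ facet g k
  · obtain ⟨v, a, b, i, k, hab, hva, he, hvi, hai, hvk, hbk⟩ := hS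
    have hstep := lcStep_of_fold hf hg hab hva he hvi hai hvk hbk
    obtain ⟨g', hg', hinj, hfg'⟩ := ih _ (by
      rw [← hn]
      refine Finset.card_lt_card (Finset.ssubset_iff_subset_ne.2 ⟨?_, fun h => ?_⟩)
      · intro x hx
        obtain ⟨p, -, rfl⟩ := Finset.mem_image.1 hx
        split_ifs
        · obtain ⟨j, rfl⟩ := mem_facet.1 hbk
          exact Finset.mem_image.2 ⟨(k, j), Finset.mem_univ _, rfl⟩
        · exact Finset.mem_image_of_mem (fun p : Fin N × Fin 3 => g p.1 p.2) (Finset.mem_univ p)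
      · obtain ⟨j, rfl⟩ := mem_facet.1 hai
        have : g i j ∈ univ.image fun p : Fin N × Fin 3 => g p.1 p.2 :=
          Finset.mem_image.2 ⟨(i, j), Finset.mem_univ _, rfl⟩
        rw [← h] at this
        obtain ⟨p, -, hp⟩ := Finset.mem_image.1 this
        grind) (fun i j => if g i j = a then b else g i j) (fun i j => by
          rw [← hg i j]
          split_ifs with h
          · rw [h, he]
          · rfl) (fun i k hik => by
          obtain ⟨j, l, hjl⟩ := hTg i k hik
          exact ⟨j, l, by simp only [hjl]⟩) rfl
    exact ⟨g', hg'.head hstep, hinj, hfg'⟩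
  · refine ⟨g, .refl, ?_, fun i j => (hg i j).symm⟩
    rintro _ ⟨i, j, rfl⟩ _ ⟨k, l, rfl⟩ h
    have hlift : ∀ i j, g i (Function.invFun (f i) (f i j)) = g i j := fun i j => by
      rw [Function.leftInverse_invFun (hf.1 i) j]
    rw [hg, hg] at h
    have := hA.lift_eq (card_facet hf.1) (fun w u hwu s hs => hf.card_le_two hwu s hs) hT
      (fun i k hik => (dualGraph_adj.1 (hTf hik)).2) (fun i w => g i (Function.invFun (f i) w))
      (by
        intro i k u w hui huk hwi hwk heq
        by_contra hne
        obtain ⟨j₁, rfl⟩ := mem_facet.1 hui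
        obtain ⟨l₁, hl₁⟩ := mem_facet.1 huk
        obtain ⟨j₂, rfl⟩ := mem_facet.1 hwi
        obtain ⟨l₂, hl₂⟩ := mem_facet.1 hwk
        rw [hlift, ← hl₂, hlift] at heq
        rw [hlift, ← hl₁, hlift] at hne
        refine hS ⟨g i j₂, g i j₁, g k l₁, i, k, hne, fun h => ?_, by rw [hg, hg, hl₁],
          mem_facet.2 ⟨_, rfl⟩, mem_facet.2 ⟨_, rfl⟩, mem_facet.2 ⟨_, heq.symm⟩,
          mem_facet.2 ⟨_, rfl⟩⟩
        have h' := congrArg e h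
        rw [hg, hg] at h'
        have hl : l₁ = l₂ := hf.1 k (by rw [hl₁, hl₂, h'])
        rw [← h, heq, hl] at hne
        exact hne rfl)
      (by
        intro i k hik
        obtain ⟨j, l, hjl⟩ := hTg i k hik
        have hfjl : f i j = f k l := by rw [← hg, ← hg, hjl]
        refine ⟨f i j, mem_facet.2 ⟨j, rfl⟩, mem_facet.2 ⟨l, hfjl.symm⟩, ?_⟩
        rw [hlift, hfjl, hlift, hjl])
      (mem_facet.2 ⟨j, rfl⟩) (mem_facet.2 ⟨l, h.symm⟩)
    rwa [hlift, h, hlift] at this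

/-- Uniting disjoint triangles along a set of edges of a dual spanning tree. -/
lemma exists_uniteSteps {f : Config V 2 N} (hf : IsPseudo f) {T : SimpleGraph (Fin N)}
    (hT : T.IsAcyclic) (hTf : T ≤ dualGraph f) (E : Finset (Sym2 (Fin N)))
    (hE : (E : Set (Sym2 (Fin N))) ⊆ T.edgeSet) :
    ∃ t : Config (Fin N × Fin 3) 2 N, Relation.ReflTransGen UniteStep (std 2 N) t ∧
      (∀ i j, f (t i j).1 (t i j).2 = f i j) ∧
      (∀ i k x, x ∈ facet t i → x ∈ facet t k →
        (SimpleGraph.fromEdgeSet (E : Set (Sym2 (Fin N)))).Reachable i k) ∧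
      dualGraph t = SimpleGraph.fromEdgeSet (E : Set (Sym2 (Fin N))) := by
  induction E using Finset.induction_on with
  | empty =>
    have hstd : ∀ i k x, x ∈ facet (std 2 N) i → x ∈ facet (std 2 N) k → i = k := by
      intro i k x hi hk
      obtain ⟨j, rfl⟩ := mem_facet.1 hi
      obtain ⟨l, hl⟩ := mem_facet.1 hk
      exact (congrArg Prod.fst hl).symm
    refine ⟨std 2 N, .refl, fun _ _ => rfl, fun i k x hi hk => ?_, ?_⟩
    · rw [hstd i k x hi hk]
    · ext i k
      rw [dualGraph_adj]
      simp only [Finset.coe_empty, SimpleGraph.fromEdgeSet_empty, SimpleGraph.bot_adj, iff_false]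
      rintro ⟨hik, u, w, -, hui, huk, -⟩
      exact hik (hstd i k u hui huk)
  | insert ed E hed ih =>
    rw [Finset.coe_insert, Set.insert_subset_iff] at hE
    obtain ⟨t, ht, htf, htr, htd⟩ := ih hE.2
    induction ed with | _ a b =>
    set F := SimpleGraph.fromEdgeSet (E : Set (Sym2 (Fin N))) with hF
    set F' := SimpleGraph.fromEdgeSet ((insert s(a, b) E : Finset _) : Set (Sym2 (Fin N))) with hF'
    have hF'adj : ∀ k l, F'.Adj k l ↔ F.Adj k l ∨ (k ≠ l ∧ s(k, l) = s(a, b)) := by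
      intro k l
      simp only [hF, hF', SimpleGraph.fromEdgeSet_adj, Finset.coe_insert, Set.mem_insert_iff]
      tauto
    have hFF' : F ≤ F' := fun k l h => (hF'adj k l).2 (Or.inl h)
    have hTab : T.Adj a b := hE.1
    have hab : ¬ F.Reachable a b := by
      have hbr := SimpleGraph.isAcyclic_iff_forall_adj_isBridge.1 hT hTab
      rw [SimpleGraph.isBridge_iff] at hbr
      refine fun h => hbr (h.mono fun k l hkl => ?_)
      rw [hF, SimpleGraph.fromEdgeSet_adj] at hkl
      rw [SimpleGraph.deleteEdges_adj]
      refine ⟨hE.2 hkl.1, fun h => hed ?_⟩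
      rw [← Set.mem_singleton_iff.1 h]
      exact hkl.1
    have hab' : F'.Reachable a b := ((hF'adj a b).2 (Or.inr ⟨hTab.ne, rfl⟩)).reachable
    obtain ⟨-, u, w, huw, hua, hub, hwa, hwb⟩ := dualGraph_adj.1 (hTf hTab)
    obtain ⟨j₁, hj₁⟩ := mem_facet.1 hua
    obtain ⟨j₂, hj₂⟩ := mem_facet.1 hwa
    obtain ⟨l₁, hl₁⟩ := mem_facet.1 hub
    obtain ⟨l₂, hl₂⟩ := mem_facet.1 hwb
    let e : Fin N × Fin 3 → V := fun p => f p.1 p.2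
    have hte : ∀ i j, e (t i j) = f i j := htf
    have hex : e (t a j₁) = u ∧ e (t a j₂) = w ∧ e (t b l₁) = u ∧ e (t b l₂) = w := by
      simp only [hte, hj₁, hj₂, hl₁, hl₂, and_self]
    have ha₁ : t a j₁ ∈ facet t a := mem_facet.2 ⟨_, rfl⟩
    have ha₂ : t a j₂ ∈ facet t a := mem_facet.2 ⟨_, rfl⟩
    have hb₁ : t b l₁ ∈ facet t b := mem_facet.2 ⟨_, rfl⟩
    have hb₂ : t b l₂ ∈ facet t b := mem_facet.2 ⟨_, rfl⟩
    generalize t a j₁ = a₁ at *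
    generalize t a j₂ = a₂ at *
    generalize t b l₁ = b₁ at *
    generalize t b l₂ = b₂ at *
    obtain ⟨hea₁, hea₂, heb₁, heb₂⟩ := hex
    have ha₁₂ : a₁ ≠ a₂ := fun h => huw (by rw [← hea₁, ← hea₂, h])
    have hb₁₂ : b₁ ≠ b₂ := fun h => huw (by rw [← heb₁, ← heb₂, h])
    have hRa : ∀ i x, x ∈ facet t i → x = a₁ ∨ x = a₂ → F.Reachable i a := by
      rintro i x hi (rfl | rfl)
      exacts [htr _ _ _ hi ha₁, htr _ _ _ hi ha₂]
    have hSb : ∀ i x, x ∈ facet t i → x = b₁ ∨ x = b₂ → F.Reachable i b := by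
      rintro i x hi (rfl | rfl)
      exacts [htr _ _ _ hi hb₁, htr _ _ _ hi hb₂]
    have hRS : ∀ x, x = a₁ ∨ x = a₂ → ¬(x = b₁ ∨ x = b₂) := by
      rintro x (rfl | rfl) h
      · exact hab (hSb a _ ha₁ h)
      · exact hab (hSb a _ ha₂ h)
    have huniq : ∀ i c c', c = a ∧ c' = b ∨ c = b ∧ c' = a → i ≠ c → F.Reachable i c →
        u ∈ facet f i → w ∈ facet f i → False := by
      intro i c c' hc hic hr hui hwi
      have hne := hTab.ne
      have hic' : i ≠ c' := by
        rintro rfl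
        rcases hc with ⟨rfl, rfl⟩ | ⟨rfl, rfl⟩
        exacts [hab hr.symm, hab hr]
      have := hf.card_le_two huw {i, a, b} (by
        intro j hj
        simp only [Finset.mem_insert, Finset.mem_singleton] at hj
        rcases hj with rfl | rfl | rfl
        exacts [⟨hui, hwi⟩, ⟨hua, hwa⟩, ⟨hub, hwb⟩])
      rw [Finset.card_insert_of_notMem (by
        simp only [Finset.mem_insert, Finset.mem_singleton]; grind), Finset.card_pair hne] at this
      omega
    have hcellR : ∀ i, a₁ ∈ facet t i → a₂ ∈ facet t i → i = a := by
      intro i h1 h2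
      by_contra hia
      exact huniq i a b (Or.inl ⟨rfl, rfl⟩) hia (htr _ _ _ h1 ha₁)
        (hea₁ ▸ map_mem_facet hte h1) (hea₂ ▸ map_mem_facet hte h2)
    have hcellS : ∀ i, b₁ ∈ facet t i → b₂ ∈ facet t i → i = b := by
      intro i h1 h2
      by_contra hib
      exact huniq i b a (Or.inr ⟨rfl, rfl⟩) hib (htr _ _ _ h1 hb₁)
        (heb₁ ▸ map_mem_facet hte h1) (heb₂ ▸ map_mem_facet hte h2)
    have hcR : cells t {a₁, a₂} = {a} := by
      ext i
      rw [mem_cells_pair, Finset.mem_singleton]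
      exact ⟨fun h => hcellR i h.1 h.2, fun h => h ▸ ⟨ha₁, ha₂⟩⟩
    have hcS : cells t {b₁, b₂} = {b} := by
      ext i
      rw [mem_cells_pair, Finset.mem_singleton]
      exact ⟨fun h => hcellS i h.1 h.2, fun h => h ▸ ⟨hb₁, hb₂⟩⟩
    let φ : Fin N × Fin 3 → Fin N × Fin 3 := fun x => if x = a₁ then b₁ else if x = a₂ then b₂ else x
    have hφa₁ : φ a₁ = b₁ := if_pos rfl
    have hφa₂ : φ a₂ = b₂ := by simp [φ, ha₁₂.symm]
    have hφ : ∀ x, ¬(x = a₁ ∨ x = a₂) → φ x = x := by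
      intro x hx
      rw [not_or] at hx
      simp [φ, hx.1, hx.2]
    have hφR : ∀ x, x = a₁ ∨ x = a₂ → φ x = b₁ ∨ φ x = b₂ := by
      rintro x (rfl | rfl)
      exacts [Or.inl hφa₁, Or.inr hφa₂]
    have hφinj : ∀ x y, (x = a₁ ∨ x = a₂) → (y = a₁ ∨ y = a₂) → φ x = φ y → x = y := by
      rintro x y (rfl | rfl) (rfl | rfl) h
      · rfl
      · exact absurd (hφa₁.symm.trans (h.trans hφa₂)) hb₁₂
      · exact absurd (hφa₁.symm.trans (h.symm.trans hφa₂)) hb₁₂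
      · rfl
    have heφ : ∀ x, e (φ x) = e x := by
      intro x
      by_cases hx : x = a₁ ∨ x = a₂
      · rcases hx with rfl | rfl
        · rw [hφa₁, hea₁, heb₁]
        · rw [hφa₂, hea₂, heb₂]
      · rw [hφ x hx]
    have hcross : ∀ x y, φ x = φ y → x ≠ y →
        ((x = a₁ ∨ x = a₂) ∧ (y = b₁ ∨ y = b₂)) ∨ ((y = a₁ ∨ y = a₂) ∧ (x = b₁ ∨ x = b₂)) := by
      intro x y h hxy
      by_cases hx : x = a₁ ∨ x = a₂
      · by_cases hy : y = a₁ ∨ y = a₂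
        · exact absurd (hφinj x y hx hy h) hxy
        · refine Or.inl ⟨hx, ?_⟩
          have := hφR x hx
          rwa [h, hφ y hy] at this
      · by_cases hy : y = a₁ ∨ y = a₂
        · refine Or.inr ⟨hy, ?_⟩
          have := hφR y hy
          rwa [← h, hφ x hx] at this
        · rw [hφ x hx, hφ y hy] at h
          exact absurd h hxy
    let t' : Config (Fin N × Fin 3) 2 N := fun i j => φ (t i j)
    have ht' : ∀ i x, x ∈ facet t' i ↔ ∃ y ∈ facet t i, φ y = x := by
      intro i x
      simp only [mem_facet]
      constructor
      · rintro ⟨j, rfl⟩; exact ⟨_, ⟨j, rfl⟩, rfl⟩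
      · rintro ⟨_, ⟨j, rfl⟩, rfl⟩; exact ⟨j, rfl⟩
    have hstep : UniteStep t t' := by
      refine ⟨{a₁, a₂}, {b₁, b₂}, ⟨Finset.card_pair ha₁₂, by rw [hcR]; rfl⟩,
        ⟨Finset.card_pair hb₁₂, by rw [hcS]; rfl⟩, ?_, ?_, φ, ?_, ?_, ?_, fun _ _ => rfl⟩
      · rw [Finset.disjoint_left]
        intro x hx hx'
        simp only [Finset.mem_insert, Finset.mem_singleton] at hx hx'
        exact hRS x hx hx'
      · intro i hi i' hi'
        rw [hcR, Finset.mem_singleton] at hi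
        rw [hcS, Finset.mem_singleton] at hi'
        rwa [hi, hi', htd]
      · intro x hx
        exact hφ x (by simpa using hx)
      · intro x hx y hy h
        exact hφinj x y (by simpa using hx) (by simpa using hy) h
      · rw [Finset.image_insert, Finset.image_singleton, hφa₁, hφa₂]
    refine ⟨t', ht.tail hstep, fun i j => (heφ (t i j)).trans (hte i j), ?_, ?_⟩
    · intro i k x hi hk
      obtain ⟨y, hy, hyx⟩ := (ht' i x).1 hi
      obtain ⟨z, hz, rfl⟩ := (ht' k x).1 hk
      by_cases hyz : y = z
      · subst hyz
        exact (htr _ _ _ hy hz).mono hFF'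
      · rcases hcross y z hyx hyz with ⟨h1, h2⟩ | ⟨h1, h2⟩
        · exact ((hRa _ _ hy h1).mono hFF').trans (hab'.trans ((hSb _ _ hz h2).mono hFF').symm)
        · exact ((hSb _ _ hy h2).mono hFF').trans
            (hab'.symm.trans ((hRa _ _ hz h1).mono hFF').symm)
    · have hends : ∀ k l x x' y y', x ∈ facet t k → x' ∈ facet t l → y ∈ facet t k →
          y' ∈ facet t l → φ x = φ x' → φ y = φ y' → φ x ≠ φ y → (x = a₁ ∨ x = a₂) →
          (x' = b₁ ∨ x' = b₂) → k = a ∧ l = b := by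
        intro k l x x' y y' hx hx' hy hy' hxx hyy hxy hxa hxb
        have hka := hRa k x hx hxa
        have hlb := hSb l x' hx' hxb
        have hyne : y ≠ y' := by
          rintro rfl
          exact hab (hka.symm.trans ((htr _ _ _ hy hy').trans hlb))
        have hy2 : (y = a₁ ∨ y = a₂) ∧ (y' = b₁ ∨ y' = b₂) := by
          rcases hcross y y' hyy hyne with h | h
          · exact h
          · exact absurd (hka.symm.trans (hSb k y hy h.2)) hab
        have hne : x ≠ y := fun h => hxy (by rw [h])
        have hne' : x' ≠ y' := fun h => hxy (by rw [hxx, hyy, h])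
        obtain ⟨hya, hyb⟩ := hy2
        constructor
        · rcases hxa with rfl | rfl <;> rcases hya with rfl | rfl
          exacts [absurd rfl hne, hcellR k hx hy, hcellR k hy hx, absurd rfl hne]
        · rcases hxb with rfl | rfl <;> rcases hyb with rfl | rfl
          exacts [absurd rfl hne', hcellS l hx' hy', hcellS l hy' hx', absurd rfl hne']
      have hab₁ : b₁ ∈ facet t' a ∧ b₂ ∈ facet t' a ∧ b₁ ∈ facet t' b ∧ b₂ ∈ facet t' b :=
        ⟨(ht' _ _).2 ⟨a₁, ha₁, hφa₁⟩, (ht' _ _).2 ⟨a₂, ha₂, hφa₂⟩,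
          (ht' _ _).2 ⟨b₁, hb₁, hφ _ fun h => hRS _ h (Or.inl rfl)⟩,
          (ht' _ _).2 ⟨b₂, hb₂, hφ _ fun h => hRS _ h (Or.inr rfl)⟩⟩
      ext k l
      rw [dualGraph_adj, hF'adj, ← htd, dualGraph_adj]
      constructor
      · rintro ⟨hkl, x, y, hxy, hxk, hxl, hyk, hyl⟩
        obtain ⟨x₁, hx₁, rfl⟩ := (ht' _ _).1 hxk
        obtain ⟨x₂, hx₂, hx⟩ := (ht' _ _).1 hxl
        obtain ⟨y₁, hy₁, rfl⟩ := (ht' _ _).1 hyk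
        obtain ⟨y₂, hy₂, hy⟩ := (ht' _ _).1 hyl
        have hgl : ∀ {x x' y y'}, x ∈ facet t k → x' ∈ facet t l → y ∈ facet t k →
            y' ∈ facet t l → φ x = φ x' → φ y = φ y' → φ x ≠ φ y → x ≠ x' →
            s(k, l) = s(a, b) := by
          intro x x' y y' hx hx' hy hy' hxx hyy hxy hne
          rcases hcross x x' hxx hne with h | h
          · obtain ⟨rfl, rfl⟩ := hends k l x x' y y' hx hx' hy hy' hxx hyy hxy h.1 h.2
            rfl
          · obtain ⟨rfl, rfl⟩ := hends l k x' x y' y hx' hx hy' hy hxx.symm hyy.symm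
              (by rwa [← hxx, ← hyy]) h.1 h.2
            exact Sym2.eq_swap
        by_cases hx12 : x₁ = x₂
        · by_cases hy12 : y₁ = y₂
          · subst hx12 hy12
            exact Or.inl ⟨hkl, x₁, y₁, fun h => hxy (by rw [h]), hx₁, hx₂, hy₁, hy₂⟩
          · exact Or.inr ⟨hkl, hgl hy₁ hy₂ hx₁ hx₂ hy.symm hx.symm hxy.symm hy12⟩
        · exact Or.inr ⟨hkl, hgl hx₁ hx₂ hy₁ hy₂ hx.symm hy.symm hxy hx12⟩
      · rintro (⟨hkl, x, y, hxy, hxk, hxl, hyk, hyl⟩ | ⟨hkl, h⟩)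
        · refine ⟨hkl, φ x, φ y, fun h => hxy ?_, (ht' _ _).2 ⟨x, hxk, rfl⟩,
            (ht' _ _).2 ⟨x, hxl, rfl⟩, (ht' _ _).2 ⟨y, hyk, rfl⟩, (ht' _ _).2 ⟨y, hyl, rfl⟩⟩
          refine injOn_facet hf.1 hte hxk hyk ?_
          rw [← heφ x, ← heφ y, h]
        · obtain ⟨h1, h2, h3, h4⟩ := hab₁
          rcases Sym2.eq_iff.1 h with ⟨rfl, rfl⟩ | ⟨rfl, rfl⟩
          · exact ⟨hkl, b₁, b₂, hb₁₂, h1, h3, h2, h4⟩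
          · exact ⟨hkl, b₁, b₂, hb₁₂, h3, h1, h4, h2⟩

end Gluing

/-- every triangulated 2-sphere and 2-disk is extensively LC:
for every spanning tree `T` of its dual graph, it is obtained from the tree of
triangles dual to `T` via LC gluings. -/
theorem stmt16 {V : Type*} [DecidableEq V] [Fintype V] {N : ℕ}
    (f : Config V 2 N) (hp : IsPseudo f)
    (htop :
      Nonempty ((realization f) ≃ₜ
        (Metric.sphere (0 : EuclideanSpace ℝ (Fin 3)) 1 :
          Set (EuclideanSpace ℝ (Fin 3)))) ∨
      Nonempty ((realization f) ≃ₜ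
        (Metric.closedBall (0 : EuclideanSpace ℝ (Fin 2)) 1 :
          Set (EuclideanSpace ℝ (Fin 2))))) :
    ∀ T : SimpleGraph (Fin N), T.IsTree → T ≤ dualGraph f →
      ∃ t g : Config (Fin N × Fin 3) 2 N,
        IsTreeOfSimplicesC t ∧ dualGraph t = T ∧
        Relation.ReflTransGen LCStep t g ∧ Represents g f := by
  intro T hT hTf
  have hX : HasSignLifts V (realization f) := by
    rcases htop with ⟨⟨h⟩⟩ | ⟨⟨h⟩⟩
    · exact hasSignLifts_sphere.of_homeomorph h
    · exact hasSignLifts_closedBall.of_homeomorph h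
  obtain ⟨t, ht, htf, -, htd⟩ := exists_uniteSteps hp hT.isAcyclic hTf
    (Set.toFinite T.edgeSet).toFinset (by simp)
  rw [Set.Finite.coe_toFinset, SimpleGraph.fromEdgeSet_edgeSet] at htd
  obtain ⟨g, hg, hinj, hfg⟩ := exists_lcSteps hp (trivialCocycles_of_hasSignLifts f hX)
    hT.connected hTf (fun p => f p.1 p.2) t htf fun i k hik => by
      rw [← htd] at hik
      obtain ⟨-, u, -, -, hui, huk, -⟩ := dualGraph_adj.1 hik
      obtain ⟨j, hj⟩ := mem_facet.1 hui
      obtain ⟨l, hl⟩ := mem_facet.1 huk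
      exact ⟨j, l, hj.trans hl.symm⟩
  exact ⟨t, g, ⟨ht, htd ▸ hT.connected⟩, htd, hg, _, hinj, hfg⟩

end MogamiPaper
end
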